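/- arXiv:0807.4103 — 5 statements merged into one kernel-verified Lean document; each statement's English description precedes it below -/
import Mathlib

section
/- Let n ∈ ℕ, n ≥ 1, let w : [a, b] → [0, ∞) be an integrable weight function, let x₁ < … < x_n be points of the open interval (a, b), and let w₁, …, w_n, w_{n+1} ∈ ℝ be such that Σ_{i=1}^n wᵢ p(xᵢ) + w_{n+1} p(b) = ∫ₐᵇ p(x) w(x) dx for every polynomial p ∈ Π_{2n} (a right Radau-type quadrature rule). Then for every 2n-convex function f : [a, b] → ℝ (any such f is Riemann integrable on [a, b]) one has ∫ₐᵇ f(x) w(x) dx ≤ Σ_{i=1}^n wᵢ f(xᵢ) + w_{n+1} f(b). -/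
/-- Divided differences of `f` at the points of a list, defined recursively:
`[x₁; f] = f x₁` and
`[x₁, …, x_{k+1}; f] = ([x₂, …, x_{k+1}; f] − [x₁, …, x_k; f]) / (x_{k+1} − x₁)`. -/
noncomputable def divDiff (f : ℝ → ℝ) : List ℝ → ℝ
  | [] => 0
  | [x] => f x
  | x :: y :: l =>
      (divDiff f (y :: l) - divDiff f (x :: (y :: l).dropLast)) /
        ((y :: l).getLast (List.cons_ne_nil y l) - x)
termination_by l => l.length
decreasing_by
  all_goals simp [List.length_dropLast]

/-- A function `f` is `n`-convex on a set `I` if all its `(n+2)`-point divided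
differences at distinct points of `I` are nonnegative. -/
def NConvexOn (n : ℕ) (I : Set ℝ) (f : ℝ → ℝ) : Prop :=
  ∀ l : List ℝ, l.length = n + 2 → l.Nodup → (∀ x ∈ l, x ∈ I) → 0 ≤ divDiff f l


section

open Finset Filter Topology Polynomial

/-- The divided difference of `f` at the points of a finite set, in its symmetric form. -/
noncomputable def finsetDivDiff (f : ℝ → ℝ) (s : Finset ℝ) : ℝ :=
  ∑ x ∈ s, f x / ∏ y ∈ s.erase x, (x - y)

lemma prod_erase_sub_ne_zero (s : Finset ℝ) (x : ℝ) : ∏ y ∈ s.erase x, (x - y) ≠ 0 :=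
  prod_ne_zero_iff.2 fun _ hy => sub_ne_zero.2 (ne_of_mem_erase hy).symm

lemma finsetDivDiff_insert (f : ℝ → ℝ) {s : Finset ℝ} {u : ℝ} (hu : u ∉ s) :
    finsetDivDiff f (insert u s) =
      f u / ∏ y ∈ s, (u - y) + ∑ x ∈ s, f x / ((x - u) * ∏ y ∈ s.erase x, (x - y)) := by
  rw [finsetDivDiff, sum_insert hu, erase_insert hu]
  congr 1
  refine sum_congr rfl fun x hx => ?_
  have hxu : u ≠ x := fun h => hu (h ▸ hx)
  rw [erase_insert_of_ne hxu, prod_insert fun h => hu (mem_of_mem_erase h)]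

lemma finsetDivDiff_insert_insert (f : ℝ → ℝ) {s : Finset ℝ} {u v : ℝ} (hu : u ∉ s) (hv : v ∉ s)
    (huv : u ≠ v) :
    finsetDivDiff f (insert u (insert v s)) =
      (finsetDivDiff f (insert v s) - finsetDivDiff f (insert u s)) / (v - u) := by
  have hvu : v - u ≠ 0 := sub_ne_zero.2 huv.symm
  have huv' : u - v ≠ 0 := sub_ne_zero.2 huv
  have hU : ∏ y ∈ s, (u - y) ≠ 0 :=
    prod_ne_zero_iff.2 fun y hy => sub_ne_zero.2 fun h => hu (h ▸ hy)
  have hV : ∏ y ∈ s, (v - y) ≠ 0 :=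
    prod_ne_zero_iff.2 fun y hy => sub_ne_zero.2 fun h => hv (h ▸ hy)
  rw [finsetDivDiff_insert f (by simp [hu, huv] : u ∉ insert v s), finsetDivDiff_insert f hv,
    finsetDivDiff_insert f hu, prod_insert hv, sum_insert hv, erase_insert hv, eq_div_iff hvu]
  have hsum : (∑ x ∈ s, f x / ((x - u) * ∏ y ∈ (insert v s).erase x, (x - y))) * (v - u) =
      ∑ x ∈ s, f x / ((x - v) * ∏ y ∈ s.erase x, (x - y)) -
        ∑ x ∈ s, f x / ((x - u) * ∏ y ∈ s.erase x, (x - y)) := by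
    rw [← sum_sub_distrib, sum_mul]
    refine sum_congr rfl fun x hx => ?_
    have hxu : x - u ≠ 0 := sub_ne_zero.2 fun h => hu (h ▸ hx)
    have hxv : v ≠ x := fun h => hv (h ▸ hx)
    have hxv' : x - v ≠ 0 := sub_ne_zero.2 hxv.symm
    have := prod_erase_sub_ne_zero s x
    rw [erase_insert_of_ne hxv, prod_insert fun h => hv (mem_of_mem_erase h)]
    field_simp
    ring
  rw [add_mul, add_mul, hsum]
  have h1 : f u / ((u - v) * ∏ y ∈ s, (u - y)) * (v - u) = -(f u / ∏ y ∈ s, (u - y)) := by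
    field_simp
    ring
  have h2 : f v / ((v - u) * ∏ y ∈ s, (v - y)) * (v - u) = f v / ∏ y ∈ s, (v - y) := by
    field_simp
  rw [h1, h2]
  ring

lemma divDiff_eq_finsetDivDiff (f : ℝ → ℝ) (l : List ℝ) (hl : l.Nodup) :
    divDiff f l = finsetDivDiff f l.toFinset := by
  induction hk : l.length using Nat.strong_induction_on generalizing l with
  | _ k ih =>
    match l, hl with
    | [], _ => simp [divDiff, finsetDivDiff]
    | [x], _ => simp [divDiff, finsetDivDiff]
    | x :: y :: l, hl =>
      rw [divDiff]
      obtain ⟨m, z, hm⟩ : ∃ m z, y :: l = m ++ [z] :=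
        ⟨_, _, (List.dropLast_append_getLast (List.cons_ne_nil y l)).symm⟩
      have hlen := congrArg List.length hm
      simp only [List.length_cons, List.length_append, List.length_nil] at hlen hk
      simp only [hm] at hl ⊢
      simp only [List.dropLast_concat, List.getLast_append_singleton]
      have hnd := List.nodup_cons.1 hl
      have hnd' := List.nodup_append.1 hnd.2
      have hxz : x ≠ z ∧ x ∉ m := by
        have := hnd.1
        simp only [List.mem_append, List.mem_singleton, not_or] at this
        exact this.symm
      have hz : z ∉ m := fun h => hnd'.2.2 z h z (by simp) rfl
      rw [ih _ (by simp; omega) (m ++ [z]) hnd.2 rfl,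
        ih _ (by simp; omega) (x :: m) (List.nodup_cons.2 ⟨hxz.2, hnd'.1⟩) rfl]
      have e : (m ++ [z]).toFinset = insert z m.toFinset := by
        ext; simp
      rw [List.toFinset_cons, List.toFinset_cons, e,
        finsetDivDiff_insert_insert f (by simpa using hxz.2) (by simpa using hz) hxz.1]

lemma NConvexOn.finsetDivDiff_nonneg {m : ℕ} {I : Set ℝ} {f : ℝ → ℝ} (hf : NConvexOn m I f)
    {s : Finset ℝ} (hs : s.card = m + 2) (hsI : ↑s ⊆ I) : 0 ≤ finsetDivDiff f s := by
  have := hf s.toList (by simpa using hs) s.nodup_toList fun x hx => hsI (by simpa using hx)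
  rwa [divDiff_eq_finsetDivDiff f _ s.nodup_toList, toList_toFinset] at this

lemma finsetDivDiff_eval_eq_zero {s : Finset ℝ} {P : ℝ[X]} (hP : P.natDegree + 1 < s.card) :
    finsetDivDiff (fun x => P.eval x) s = 0 := by
  have hdeg : P.degree < s.card :=
    lt_of_le_of_lt degree_le_natDegree (by exact_mod_cast (by omega : P.natDegree < s.card))
  have h := Lagrange.coeff_eq_sum (s := s) (v := id) Function.injective_id.injOn hdeg
  rw [coeff_eq_zero_of_natDegree_lt (by omega)] at h
  simpa [finsetDivDiff] using h.symm

lemma finsetDivDiff_sub (f g : ℝ → ℝ) (s : Finset ℝ) :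
    finsetDivDiff (fun x => f x - g x) s = finsetDivDiff f s - finsetDivDiff g s := by
  simp only [finsetDivDiff, sub_div, sum_sub_distrib]

lemma eval_interpolate_id {s : Finset ℝ} (f : ℝ → ℝ) {x : ℝ} (hx : x ∈ s) :
    (Lagrange.interpolate s id f).eval x = f x := by
  simpa using Lagrange.eval_interpolate_at_node (v := id) f Function.injective_id.injOn hx

lemma natDegree_interpolate_id_le {s : Finset ℝ} (f : ℝ → ℝ) {k : ℕ} (hs : s.card = k + 1) :
    (Lagrange.interpolate s id f).natDegree ≤ k := by
  have := Lagrange.degree_interpolate_le (s := s) (v := id) f Function.injective_id.injOn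
  rw [hs, Nat.add_sub_cancel] at this
  exact natDegree_le_of_degree_le this

lemma NConvexOn.sub_interpolate_mul_prod_nonneg {m : ℕ} {I : Set ℝ} {f : ℝ → ℝ}
    (hf : NConvexOn m I f) {s : Finset ℝ} (hs : s.card = m + 1) (hsI : ↑s ⊆ I)
    {x : ℝ} (hx : x ∈ I) :
    0 ≤ (f x - (Lagrange.interpolate s id f).eval x) * ∏ y ∈ s, (x - y) := by
  set P := Lagrange.interpolate s id f
  have hP : ∀ y ∈ s, f y - P.eval y = 0 := fun y hy => sub_eq_zero.2 (eval_interpolate_id f hy).symm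
  by_cases hxs : x ∈ s
  · simp [hP x hxs]
  have hdeg : P.natDegree ≤ m := natDegree_interpolate_id_le f hs
  have hcard : (insert x s).card = m + 2 := by rw [card_insert_of_notMem hxs, hs]
  have h0 := hf.finsetDivDiff_nonneg hcard (by
    rw [coe_insert]
    exact Set.insert_subset hx hsI)
  have h1 := finsetDivDiff_sub f (fun x => P.eval x) (insert x s)
  rw [finsetDivDiff_eval_eq_zero (by omega), sub_zero, finsetDivDiff_insert _ hxs,
    sum_eq_zero fun y hy => by simp [hP y hy], add_zero] at h1
  have hne : ∏ y ∈ s, (x - y) ≠ 0 :=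
    prod_ne_zero_iff.2 fun y hy => sub_ne_zero.2 fun h => hxs (h ▸ hy)
  rw [← h1] at h0
  have := mul_nonneg h0 (sq_nonneg (∏ y ∈ s, (x - y)))
  rwa [sq, ← mul_assoc, div_mul_cancel₀ _ hne] at this

/-- A function that is `m`-convex on `[a, b]` lies between two interpolation polynomials: the two
sets of nodes share `m` inner points and are completed by `a` and by `b` respectively. -/
lemma NConvexOn.mul_sub_interpolate_nonpos {m : ℕ} {a b : ℝ} {f : ℝ → ℝ}
    (hf : NConvexOn m (Set.Icc a b) f) {t : Finset ℝ} (ht : t.card = m)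
    (htI : ↑t ⊆ Set.Ioo a b) (hab : a ≤ b) {x : ℝ} (hx : x ∈ Set.Icc a b) :
    (f x - (Lagrange.interpolate (insert a t) id f).eval x) *
      (f x - (Lagrange.interpolate (insert b t) id f).eval x) ≤ 0 := by
  have ha : a ∉ t := fun h => (htI h).1.false
  have hb : b ∉ t := fun h => (htI h).2.false
  have htc : ↑t ⊆ Set.Icc a b := htI.trans Set.Ioo_subset_Icc_self
  by_cases hxa : x = a
  · rw [eval_interpolate_id f (by simp [hxa])]
    simp
  by_cases hxb : x = b
  · rw [eval_interpolate_id (s := insert b t) f (by simp [hxb])]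
    simp
  by_cases hxt : x ∈ t
  · rw [eval_interpolate_id f (by simp [hxt])]
    simp
  have h1 := hf.sub_interpolate_mul_prod_nonneg (s := insert a t)
    (by rw [card_insert_of_notMem ha, ht])
    (by rw [coe_insert]; exact Set.insert_subset ⟨le_rfl, hab⟩ htc) hx
  have h2 := hf.sub_interpolate_mul_prod_nonneg (s := insert b t)
    (by rw [card_insert_of_notMem hb, ht])
    (by rw [coe_insert]; exact Set.insert_subset ⟨hab, le_rfl⟩ htc) hx
  rw [prod_insert ha] at h1
  rw [prod_insert hb] at h2
  have hT : ∏ y ∈ t, (x - y) ≠ 0 :=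
    prod_ne_zero_iff.2 fun y hy => sub_ne_zero.2 fun h => hxt (h ▸ hy)
  have hneg : (x - a) * (x - b) * (∏ y ∈ t, (x - y)) ^ 2 < 0 :=
    mul_neg_of_neg_of_pos (mul_neg_of_pos_of_neg
      (sub_pos.2 (lt_of_le_of_ne hx.1 (Ne.symm hxa))) (sub_neg.2 (lt_of_le_of_ne hx.2 hxb)))
      (by positivity)
  refine nonpos_of_mul_nonneg_left (b := (x - a) * (x - b) * (∏ y ∈ t, (x - y)) ^ 2) ?_ hneg
  have := mul_nonneg h1 h2
  convert this using 1
  ring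

lemma abs_sub_le_of_mul_sub_nonpos {y p q c : ℝ} (h : (y - p) * (y - q) ≤ 0) :
    |y - c| ≤ |p - c| + |q - c| := by
  have h1 := abs_nonneg (p - c)
  have h2 := abs_nonneg (q - c)
  have h3 := le_abs_self (p - c)
  have h4 := le_abs_self (q - c)
  have h5 := neg_abs_le (p - c)
  have h6 := neg_abs_le (q - c)
  rw [abs_le]
  rcases mul_nonpos_iff.1 h with ⟨_, _⟩ | ⟨_, _⟩ <;> constructor <;> linarith

lemma NConvexOn.continuousAt {m : ℕ} (hm : 1 ≤ m) {a b : ℝ} {f : ℝ → ℝ}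
    (hf : NConvexOn m (Set.Icc a b) f) {c : ℝ} (hc : c ∈ Set.Ioo a b) : ContinuousAt f c := by
  have hab : a < b := hc.1.trans hc.2
  obtain ⟨t, ht, htc⟩ :=
    ((Set.Ioo_infinite hab).sdiff (Set.finite_singleton c)).exists_subset_card_eq (m - 1)
  have hct : c ∉ t := fun h => (ht h).2 rfl
  have hcard : (insert c t).card = m := by rw [card_insert_of_notMem hct]; omega
  have hsub : ↑(insert c t) ⊆ Set.Ioo a b := by
    rw [coe_insert]
    exact Set.insert_subset hc fun y hy => (ht hy).1
  set A := Lagrange.interpolate (insert a (insert c t)) id f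
  set B := Lagrange.interpolate (insert b (insert c t)) id f
  have hA : A.eval c = f c := eval_interpolate_id f (by simp)
  have hB : B.eval c = f c := eval_interpolate_id f (by simp)
  have hlim : Tendsto (fun x => |A.eval x - f c| + |B.eval x - f c|) (𝓝 c) (𝓝 0) := by
    have : Continuous fun x => |A.eval x - f c| + |B.eval x - f c| := by fun_prop
    simpa [hA, hB] using this.tendsto c
  rw [ContinuousAt, tendsto_iff_norm_sub_tendsto_zero]
  refine squeeze_zero' (Eventually.of_forall fun x => norm_nonneg _) ?_ hlim
  filter_upwards [Icc_mem_nhds hc.1 hc.2] with x hx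
  exact abs_sub_le_of_mul_sub_nonpos (hf.mul_sub_interpolate_nonpos hcard hsub hab.le hx)

lemma NConvexOn.exists_abs_le {m : ℕ} {a b : ℝ} {f : ℝ → ℝ}
    (hf : NConvexOn m (Set.Icc a b) f) (hab : a < b) : ∃ C, ∀ x ∈ Set.Icc a b, |f x| ≤ C := by
  obtain ⟨t, ht, htc⟩ := (Set.Ioo_infinite hab).exists_subset_card_eq m
  set A := Lagrange.interpolate (insert a t) id f
  set B := Lagrange.interpolate (insert b t) id f
  have hcont : Continuous fun x => |A.eval x| + |B.eval x| := by fun_prop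
  obtain ⟨C, hC⟩ := (isCompact_Icc (a := a) (b := b)).bddAbove_image hcont.continuousOn
  refine ⟨C, fun x hx => le_trans ?_ (hC ⟨x, hx, rfl⟩)⟩
  have := abs_sub_le_of_mul_sub_nonpos (c := 0)
    (hf.mul_sub_interpolate_nonpos htc ht hab.le hx)
  rwa [sub_zero, sub_zero, sub_zero] at this

open MeasureTheory in
lemma NConvexOn.intervalIntegrable_mul {m : ℕ} (hm : 1 ≤ m) {a b : ℝ} {f w : ℝ → ℝ}
    (hf : NConvexOn m (Set.Icc a b) f) (hab : a < b) (hw : IntervalIntegrable w volume a b) :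
    IntervalIntegrable (fun t => f t * w t) volume a b := by
  obtain ⟨C, hC⟩ := hf.exists_abs_le hab
  rw [intervalIntegrable_iff_integrableOn_Ioo_of_le hab.le] at hw ⊢
  refine Integrable.bdd_mul (c := C) hw ?_ ?_
  · exact ContinuousOn.aestronglyMeasurable
      (fun x hx => (hf.continuousAt hm hx).continuousWithinAt) measurableSet_Ioo
  · exact ae_restrict_of_forall_mem measurableSet_Ioo fun x hx =>
      hC x (Set.Ioo_subset_Icc_self hx)

variable {ι : Type*}

/-- The shift `h` is so small that the intervals `[x i, x i + h]` are disjoint and to the left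
of `b`. -/
def IsSmallShift (x : ι → ℝ) (b h : ℝ) : Prop :=
  0 < h ∧ (∀ i, x i + h < b) ∧ ∀ i j, i ≠ j → 0 < (x i + h - x j) * (x i - x j)

lemma IsSmallShift.injective {x : ι → ℝ} {b h : ℝ} (hh : IsSmallShift x b h) :
    Function.Injective
      fun o : Option (ι ⊕ ι) => o.elim b (Sum.elim x fun i => x i + h) := by
  obtain ⟨h0, hb, hs⟩ := hh
  have hx : ∀ i j, x i = x j → i = j := fun i j e => by
    by_contra hij
    have := hs i j hij
    rw [e] at this
    simp at this
  have hx' : ∀ i j, x i + h ≠ x j := fun i j e => by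
    by_cases hij : i = j
    · subst hij; linarith
    have := hs i j hij
    rw [e] at this
    simp at this
  have hb' : ∀ i, x i < b := fun i => by linarith [hb i]
  rintro (_ | i | i) (_ | j | j) e <;> simp only [Option.elim, Sum.elim_inl, Sum.elim_inr] at e
  · rfl
  · exact absurd e (hb' j).ne'
  · exact absurd e (hb j).ne'
  · exact absurd e (hb' i).ne
  · rw [hx i j e]
  · exact absurd e.symm (hx' j i)
  · exact absurd e (hb i).ne
  · exact absurd e (hx' i j)
  · rw [hx i j (add_right_cancel e)]

variable [Fintype ι]

/-- The points `x i` and `x i + h` together with `b`: as `h` tends to `0`, the nodes `x i` become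
double. -/
noncomputable def splitNodes (x : ι → ℝ) (b h : ℝ) : Finset ℝ :=
  univ.image fun o : Option (ι ⊕ ι) => o.elim b (Sum.elim x fun i => x i + h)

lemma mem_splitNodes {x : ι → ℝ} {b h y : ℝ} :
    y ∈ splitNodes x b h ↔ y = b ∨ (∃ i, y = x i) ∨ ∃ i, y = x i + h := by
  simp [splitNodes, Option.exists, eq_comm]

lemma eventually_isSmallShift {x : ι → ℝ} (hx : Function.Injective x) {b : ℝ}
    (hb : ∀ i, x i < b) : ∀ᶠ h in 𝓝[>] 0, IsSmallShift x b h := by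
  refine Eventually.and self_mem_nhdsWithin (((eventually_all.2 fun i => ?_).and
    (eventually_all.2 fun i => eventually_all.2 fun j => ?_)).filter_mono nhdsWithin_le_nhds)
  · have : Tendsto (fun h => x i + h) (𝓝 0) (𝓝 (x i + 0)) :=
      (continuous_const.add continuous_id).tendsto 0
    exact this.eventually_lt_const (by simpa using hb i)
  · by_cases hij : i = j
    · simp [hij]
    have : Tendsto (fun h => (x i + h - x j) * (x i - x j)) (𝓝 0)
        (𝓝 ((x i + 0 - x j) * (x i - x j))) :=
      Continuous.tendsto (by fun_prop : Continuous fun h => (x i + h - x j) * (x i - x j)) 0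
    have hne : x i - x j ≠ 0 := sub_ne_zero.2 (hx.ne hij)
    filter_upwards [this.eventually_const_lt (by
      rw [add_zero]; exact mul_self_pos.2 hne : 0 < (x i + 0 - x j) * (x i - x j))] with h hh _ using hh

lemma IsSmallShift.card_splitNodes {x : ι → ℝ} {b h : ℝ} (hh : IsSmallShift x b h) :
    (splitNodes x b h).card = 2 * Fintype.card ι + 1 := by
  rw [splitNodes, card_image_of_injective _ hh.injective]
  simp [two_mul]

lemma IsSmallShift.prod_splitNodes {x : ι → ℝ} {b h : ℝ} (hh : IsSmallShift x b h)
    (g : ℝ → ℝ) : ∏ y ∈ splitNodes x b h, g y = g b * ∏ i, g (x i) * g (x i + h) := by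
  rw [splitNodes, prod_image hh.injective.injOn, Fintype.prod_option, Fintype.prod_sum_type,
    prod_mul_distrib]
  rfl

lemma IsSmallShift.splitNodes_subset {x : ι → ℝ} {a b h : ℝ} (hh : IsSmallShift x b h)
    (hab : a < b) (hx : ∀ i, x i ∈ Set.Ioo a b) : ↑(splitNodes x b h) ⊆ Set.Ioc a b := by
  intro y hy
  rcases mem_splitNodes.1 hy with rfl | ⟨i, rfl⟩ | ⟨i, rfl⟩
  · exact ⟨hab, le_rfl⟩
  · exact Set.Ioo_subset_Ioc_self (hx i)
  · exact ⟨by linarith [(hx i).1, hh.1], (hh.2.1 i).le⟩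

lemma NConvexOn.le_interpolate_splitNodes {a b : ℝ} {f : ℝ → ℝ}
    (hf : NConvexOn (2 * Fintype.card ι) (Set.Icc a b) f) {x : ι → ℝ} {h : ℝ}
    (hh : IsSmallShift x b h) (hx : ∀ i, x i ∈ Set.Ioo a b) {t : ℝ} (ht : t ∈ Set.Ico a b)
    (htx : ∀ i, 0 < (t - x i) * (t - (x i + h))) :
    f t ≤ (Lagrange.interpolate (splitNodes x b h) id f).eval t := by
  have h1 := hf.sub_interpolate_mul_prod_nonneg hh.card_splitNodes
    ((hh.splitNodes_subset (ht.1.trans_lt ht.2) hx).trans Set.Ioc_subset_Icc_self)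
    (Set.Ico_subset_Icc_self ht)
  rw [hh.prod_splitNodes] at h1
  exact sub_nonpos.1 (nonpos_of_mul_nonneg_left h1
    (mul_neg_of_neg_of_pos (sub_neg.2 ht.2) (prod_pos fun i _ => htx i)))

lemma NConvexOn.eventually_le_interpolate_splitNodes {a b : ℝ} {f : ℝ → ℝ}
    (hf : NConvexOn (2 * Fintype.card ι) (Set.Icc a b) f) {x : ι → ℝ}
    (hx : Function.Injective x) (hxI : ∀ i, x i ∈ Set.Ioo a b) {t : ℝ} (ht : t ∈ Set.Icc a b) :
    ∀ᶠ h in 𝓝[>] 0, f t ≤ (Lagrange.interpolate (splitNodes x b h) id f).eval t := by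
  by_cases hts : t = b ∨ ∃ i, t = x i
  · refine Eventually.of_forall fun h => (eval_interpolate_id f ?_).ge
    exact mem_splitNodes.2 (hts.imp_right Or.inl)
  rw [not_or, not_exists] at hts
  have hsep : ∀ᶠ h in 𝓝[>] 0, ∀ i, 0 < (t - x i) * (t - (x i + h)) := by
    refine (eventually_all.2 fun i => ?_).filter_mono nhdsWithin_le_nhds
    have : Tendsto (fun h => (t - x i) * (t - (x i + h))) (𝓝 0)
        (𝓝 ((t - x i) * (t - (x i + 0)))) :=
      Continuous.tendsto (by fun_prop : Continuous fun h => (t - x i) * (t - (x i + h))) 0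
    have hne : t - x i ≠ 0 := sub_ne_zero.2 (hts.2 i)
    exact this.eventually_const_lt (by rw [add_zero]; exact mul_self_pos.2 hne)
  filter_upwards [eventually_isSmallShift hx fun i => (hxI i).2, hsep] with h hh hth
  exact hf.le_interpolate_splitNodes hh hxI ⟨ht.1, lt_of_le_of_ne ht.2 hts.1⟩ hth

lemma IsSmallShift.prod_erase_left_neg {x : ι → ℝ} {a b h : ℝ} (hh : IsSmallShift x b h)
    (hab : a < b) (hx : ∀ i, x i ∈ Set.Ioo a b) :
    ∏ z ∈ (insert a (splitNodes x b h)).erase a, (a - z) < 0 := by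
  have ha : a ∉ splitNodes x b h := fun ha => (hh.splitNodes_subset hab hx ha).1.false
  rw [erase_insert ha, hh.prod_splitNodes]
  refine mul_neg_of_neg_of_pos (sub_neg.2 hab) (prod_pos fun i _ => mul_pos_of_neg_of_neg ?_ ?_)
  · linarith [(hx i).1]
  · linarith [(hx i).1, hh.1]

lemma IsSmallShift.prod_erase_shift_neg {x : ι → ℝ} {a b h : ℝ} (hh : IsSmallShift x b h)
    (hab : a < b) (hx : ∀ i, x i ∈ Set.Ioo a b) (i : ι) :
    ∏ z ∈ (insert a (splitNodes x b h)).erase (x i + h), (x i + h - z) < 0 := by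
  have ha : a ∉ splitNodes x b h := fun ha => (hh.splitNodes_subset hab hx ha).1.false
  have h0 := hh.1
  have hai : a < x i + h := by linarith [(hx i).1]
  have hbi := hh.2.1 i
  rw [← filter_ne', prod_filter, prod_insert ha, hh.prod_splitNodes, if_pos hai.ne,
    if_pos hbi.ne']
  refine mul_neg_of_pos_of_neg (sub_pos.2 hai) (mul_neg_of_neg_of_pos (sub_neg.2 hbi)
    (prod_pos fun j _ => ?_))
  by_cases hij : i = j
  · subst hij
    rw [if_pos (by linarith), if_neg (by simp)]
    linarith
  have hpos := hh.2.2 i j hij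
  have h1 : x j ≠ x i + h := fun e => by rw [← e] at hpos; simp at hpos
  have h2 : x j + h ≠ x i + h := fun e => by rw [add_right_cancel e] at hpos; simp at hpos
  rw [if_pos h1, if_pos h2]
  rwa [add_sub_add_right_eq_sub]

/-- A polynomial of degree at most `2 * card ι` that agrees with `f` at the points `x i` and `b`
and majorizes it at the other points of `insert a (splitNodes x b h)` exceeds it there by a bounded
amount only. -/
lemma IsSmallShift.eval_sub_le {x : ι → ℝ} {a b h : ℝ} (hh : IsSmallShift x b h)
    (hab : a < b) (hx : ∀ i, x i ∈ Set.Ioo a b) {f : ℝ → ℝ} {P : ℝ[X]}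
    (hP : P.natDegree ≤ 2 * Fintype.card ι) (hPx : ∀ i, P.eval (x i) = f (x i))
    (hPb : P.eval b = f b) (hPa : f a ≤ P.eval a) (hPh : ∀ i, f (x i + h) ≤ P.eval (x i + h))
    (i : ι) :
    P.eval (x i + h) - f (x i + h) ≤
      -finsetDivDiff f (insert a (splitNodes x b h)) *
        ∏ z ∈ (insert a (splitNodes x b h)).erase (x i + h), (x i + h - z) := by
  have ha : a ∉ splitNodes x b h := fun ha => (hh.splitNodes_subset hab hx ha).1.false
  set Z := insert a (splitNodes x b h) with hZ
  have hcard : Z.card = 2 * Fintype.card ι + 2 := by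
    rw [hZ, card_insert_of_notMem ha, hh.card_splitNodes]
  have hi : x i + h ∈ Z := mem_insert_of_mem (mem_splitNodes.2 (Or.inr (Or.inr ⟨i, rfl⟩)))
  have hW := hh.prod_erase_shift_neg hab hx i
  have hD := finsetDivDiff_sub f (fun t => P.eval t) Z
  rw [finsetDivDiff_eval_eq_zero (by omega), sub_zero, finsetDivDiff] at hD
  have hterm : ∀ z ∈ Z, 0 ≤ (f z - P.eval z) / ∏ y ∈ Z.erase z, (z - y) := by
    intro z hz
    rcases mem_insert.1 hz with rfl | hz
    · exact div_nonneg_of_nonpos (sub_nonpos.2 hPa) (hh.prod_erase_left_neg hab hx).le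
    · rcases mem_splitNodes.1 hz with rfl | ⟨j, rfl⟩ | ⟨j, rfl⟩
      · simp [hPb]
      · simp [hPx j]
      · exact div_nonneg_of_nonpos (sub_nonpos.2 (hPh j)) (hh.prod_erase_shift_neg hab hx j).le
  have hle := single_le_sum hterm hi
  rw [hD, div_le_iff_of_neg hW] at hle
  linarith

/-- The Hermite-type majorant of a `2n`-convex function: a polynomial of degree at most `2n` above
`f` that agrees with `f` at `n` inner points and at the right endpoint. -/
lemma NConvexOn.exists_polynomial_majorant {a b : ℝ} {f : ℝ → ℝ}
    (hf : NConvexOn (2 * Fintype.card ι) (Set.Icc a b) f) (hab : a < b) {x : ι → ℝ}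
    (hx : Function.Injective x) (hxI : ∀ i, x i ∈ Set.Ioo a b) :
    ∃ H : ℝ[X], H.natDegree ≤ 2 * Fintype.card ι ∧ (∀ i, H.eval (x i) = f (x i)) ∧
      H.eval b = f b ∧ ∀ t ∈ Set.Icc a b, f t ≤ H.eval t := by
  set P : ℝ → ℝ[X] := fun h => Lagrange.interpolate (splitNodes x b h) id f
  have hsmall := eventually_isSmallShift hx fun i => (hxI i).2
  have hPx : ∀ h i, (P h).eval (x i) = f (x i) := fun h i =>
    eval_interpolate_id f (mem_splitNodes.2 (Or.inr (Or.inl ⟨i, rfl⟩)))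
  have hPb : ∀ h, (P h).eval b = f b := fun h =>
    eval_interpolate_id f (mem_splitNodes.2 (Or.inl rfl))
  have hmaj : ∀ t ∈ Set.Icc a b, ∀ᶠ h in 𝓝[>] 0, f t ≤ (P h).eval t := fun t ht =>
    hf.eventually_le_interpolate_splitNodes hx hxI ht
  obtain ⟨d, hd⟩ := hsmall.exists
  have hdI : ↑(splitNodes x b d) ⊆ Set.Icc a b :=
    (hd.splitNodes_subset hab hxI).trans Set.Ioc_subset_Icc_self
  have hbound : ∀ y ∈ splitNodes x b d, ∃ C, ∀ᶠ h in 𝓝[>] 0, (P h).eval y ∈ Set.Icc (f y) C := by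
    intro y hy
    rcases mem_splitNodes.1 hy with rfl | ⟨i, rfl⟩ | ⟨i, rfl⟩
    · exact ⟨f y, Eventually.of_forall fun h => by simp [hPb h]⟩
    · exact ⟨f (x i), Eventually.of_forall fun h => by simp [hPx h i]⟩
    · refine ⟨-finsetDivDiff f (insert a (splitNodes x b d)) *
        ∏ z ∈ (insert a (splitNodes x b d)).erase (x i + d), (x i + d - z) + f (x i + d), ?_⟩
      filter_upwards [hsmall, hmaj a ⟨le_rfl, hab.le⟩, eventually_all.2 fun j =>
        hmaj (x j + d) (hdI (mem_splitNodes.2 (Or.inr (Or.inr ⟨j, rfl⟩))))] with h hh hha hhd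
      exact ⟨hhd i, sub_le_iff_le_add.1 (hd.eval_sub_le hab hxI
        (natDegree_interpolate_id_le f hh.card_splitNodes) (hPx h) (hPb h) hha hhd i)⟩
  set U : Ultrafilter ℝ := Ultrafilter.of (𝓝[>] 0)
  have hU : ↑U ≤ 𝓝[>] (0 : ℝ) := Ultrafilter.of_le _
  have hlim : ∀ y, ∃ v, y ∈ splitNodes x b d → Tendsto (fun h => (P h).eval y) U (𝓝 v) := by
    intro y
    by_cases hy : y ∈ splitNodes x b d
    · obtain ⟨C, hC⟩ := hbound y hy
      obtain ⟨v, -, hv⟩ := isCompact_Icc.ultrafilter_le_nhds'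
        (U.map fun h => (P h).eval y) (hC.filter_mono hU)
      exact ⟨v, fun _ => hv⟩
    · exact ⟨0, fun h => absurd h hy⟩
  choose v hv using hlim
  have hH : ∀ t, Tendsto (fun h => (P h).eval t) U
      (𝓝 ((Lagrange.interpolate (splitNodes x b d) id v).eval t)) := by
    intro t
    have h1 : Tendsto (fun h => (Lagrange.interpolate (splitNodes x b d) id
        fun y => (P h).eval y).eval t) U
        (𝓝 ((Lagrange.interpolate (splitNodes x b d) id v).eval t)) := by
      simp only [Lagrange.interpolate_apply, eval_finsetSum, eval_mul, eval_C]
      exact tendsto_finsetSum _ fun y hy => (hv y hy).mul_const _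
    refine h1.congr' ((hsmall.filter_mono hU).mono fun h hh => ?_)
    have hdeg : (P h).degree < (splitNodes x b d).card := by
      have := Lagrange.degree_interpolate_lt (s := splitNodes x b h) (v := id) f
        Function.injective_id.injOn
      rwa [hh.card_splitNodes, ← hd.card_splitNodes] at this
    have := Lagrange.eq_interpolate (v := id) Function.injective_id.injOn hdeg
    exact (congrArg (eval t) this).symm
  refine ⟨_, natDegree_interpolate_id_le v hd.card_splitNodes, fun i => ?_, ?_, fun t ht => ?_⟩
  · exact tendsto_nhds_unique (hH (x i)) (by simp only [hPx]; exact tendsto_const_nhds)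
  · exact tendsto_nhds_unique (hH b) (by simp only [hPb]; exact tendsto_const_nhds)
  · exact ge_of_tendsto (hH t) ((hmaj t ht).filter_mono hU)

end

open MeasureTheory in
/-- Proposition 2, second inequality (right Radau-type quadratures): a quadrature
rule using `n` nodes in `(a, b)` and the right endpoint which is exact on `Π_{2n}`
overestimates the weighted integral of every `2n`-convex function. -/
theorem integral_le_radau_right_quadrature
    (n : ℕ) (hn : 1 ≤ n) (a b : ℝ)
    (w : ℝ → ℝ) (hw_int : IntervalIntegrable w volume a b)
    (hw_nonneg : ∀ x ∈ Set.Icc a b, 0 ≤ w x)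
    (x : Fin n → ℝ) (hx : StrictMono x) (hxI : ∀ i, x i ∈ Set.Ioo a b)
    (wt : Fin n → ℝ) (wn : ℝ)
    (hexact : ∀ p : Polynomial ℝ, p.natDegree ≤ 2 * n →
      (∑ i, wt i * p.eval (x i)) + wn * p.eval b = ∫ t in a..b, p.eval t * w t)
    (f : ℝ → ℝ) (hf : NConvexOn (2 * n) (Set.Icc a b) f) :
    (∫ t in a..b, f t * w t) ≤ (∑ i, wt i * f (x i)) + wn * f b := by
  have hab : a < b := (hxI ⟨0, hn⟩).1.trans (hxI ⟨0, hn⟩).2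
  obtain ⟨H, hHdeg, hHx, hHb, hHf⟩ :=
    NConvexOn.exists_polynomial_majorant (ι := Fin n) (by rwa [Fintype.card_fin]) hab
      hx.injective hxI
  rw [Fintype.card_fin] at hHdeg
  have hexH := hexact H hHdeg
  simp only [hHx, hHb] at hexH
  rw [hexH]
  exact intervalIntegral.integral_mono_on hab.le
    (hf.intervalIntegrable_mul (by omega) hab hw_int)
    (hw_int.continuousOn_mul H.continuous.continuousOn)
    fun t ht => mul_le_mul_of_nonneg_right (hHf t ht) (hw_nonneg t ht)
end

section
/- If f : [−1, 1] → ℝ is 3-convex (any such f is Riemann integrable on [−1, 1]), then G₂(f) ≤ C(f) ≤ ∫_{−1}^{1} f(x) dx, where G₂(f) = f(−√3/3) + f(√3/3) and C(f) = (2/3)(f(−√2/2) + f(0) + f(√2/2)). -/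
/-- The quadratic polynomial interpolating `f` at the nodes `-a`, `0`, `a`. -/
noncomputable def quadInterp (f : ℝ → ℝ) (a x : ℝ) : ℝ :=
  f 0 + (f a - f (-a)) / (2 * a) * x + (f a + f (-a) - 2 * f 0) / (2 * a ^ 2) * x ^ 2

/-- The divided difference of `f` at `-a`, `0`, `a`, `x`, as a function of `x`. -/
noncomputable def nodeQuotient (f : ℝ → ℝ) (a x : ℝ) : ℝ :=
  (f x - quadInterp f a x) / (x * (x ^ 2 - a ^ 2))

lemma eq_quadInterp_add {a : ℝ} (ha : a ≠ 0) (f : ℝ → ℝ) (x : ℝ) :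
    f x = quadInterp f a x + x * (x ^ 2 - a ^ 2) * nodeQuotient f a x := by
  unfold nodeQuotient
  by_cases h : x * (x ^ 2 - a ^ 2) = 0
  · rw [h, zero_mul, add_zero]
    rcases mul_eq_zero.1 h with rfl | h
    · simp [quadInterp]
    · rcases sq_eq_sq_iff_eq_or_eq_neg.1 (sub_eq_zero.1 h) with rfl | rfl <;>
      · unfold quadInterp
        field_simp
        ring
  · rw [mul_div_cancel₀ _ h]
    ring

lemma divDiff_eq_nodeQuotient_sub_div {a x y : ℝ} (ha : a ≠ 0)
    (hx : x ∉ ({-a, 0, a} : Set ℝ)) (hy : y ∉ ({-a, 0, a} : Set ℝ)) (f : ℝ → ℝ) :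
    divDiff f [x, -a, 0, a, y] = (nodeQuotient f a y - nodeQuotient f a x) / (y - x) := by
  simp only [Set.mem_insert_iff, Set.mem_singleton_iff, not_or] at hx hy
  obtain ⟨hx₁, hx₂, hx₃⟩ := hx
  obtain ⟨hy₁, hy₂, hy₃⟩ := hy
  have left : divDiff f [x, -a, 0, a] = nodeQuotient f a x := by
    have h₁ : x - a ≠ 0 := sub_ne_zero.2 hx₃
    have h₂ : x + a ≠ 0 := by rwa [Ne, add_eq_zero_iff_eq_neg]
    simp only [divDiff, nodeQuotient, quadInterp, List.dropLast, List.getLast]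
    rw [show x ^ 2 - a ^ 2 = (x - a) * (x + a) by ring, show a - x = -(x - a) by ring,
      show -a - x = -(x + a) by ring, show a - -a = 2 * a by ring]
    simp only [zero_sub, sub_zero, neg_neg]
    field_simp
    ring
  have right : divDiff f [-a, 0, a, y] = nodeQuotient f a y := by
    have h₁ : y - a ≠ 0 := sub_ne_zero.2 hy₃
    have h₂ : y + a ≠ 0 := by rwa [Ne, add_eq_zero_iff_eq_neg]
    simp only [divDiff, nodeQuotient, quadInterp, List.dropLast, List.getLast]
    rw [show y ^ 2 - a ^ 2 = (y - a) * (y + a) by ring, show y - -a = y + a by ring,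
      show a - -a = 2 * a by ring]
    simp only [zero_sub, sub_zero, neg_neg]
    field_simp
    ring
  rw [← left, ← right, divDiff]
  rfl

lemma NConvexOn.monotoneOn_nodeQuotient {f : ℝ → ℝ} {I : Set ℝ} (hf : NConvexOn 3 I f) {a : ℝ}
    (ha : a ≠ 0) (hI : {-a, 0, a} ⊆ I) :
    MonotoneOn (nodeQuotient f a) (I \ {-a, 0, a}) := by
  intro x hx y hy hxy
  rcases hxy.eq_or_lt with rfl | hlt
  · rfl
  have key := hf [x, -a, 0, a, y] rfl ?_ ?_
  · rw [divDiff_eq_nodeQuotient_sub_div ha hx.2 hy.2, div_nonneg_iff] at key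
    rcases key with h | h <;> linarith [h.1, h.2]
  · have hx' := hx.2
    have hy' := hy.2
    simp only [Set.mem_insert_iff, Set.mem_singleton_iff, not_or] at hx' hy'
    have haa : -a ≠ a := fun h => ha (by linarith)
    simp [hx', ha, haa, hlt.ne, Ne.symm hy'.1, Ne.symm hy'.2.1, Ne.symm hy'.2.2, ha.symm]
  · simp only [Set.insert_subset_iff, Set.singleton_subset_iff] at hI
    simp [hx.1, hy.1, hI]

lemma MonotoneOn.exists_separator {φ : ℝ → ℝ} {s : Set ℝ} (hφ : MonotoneOn φ s) (c : ℝ)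
    (hs : (s ∩ Set.Iio c).Nonempty) (hs' : (s ∩ Set.Ioi c).Nonempty) :
    ∃ m, (∀ x ∈ s, x < c → φ x ≤ m) ∧ ∀ x ∈ s, c < x → m ≤ φ x := by
  obtain ⟨m, hm, hm'⟩ := exists_between_of_forall_le (hs.image φ) (hs'.image φ) (by
    rintro _ ⟨x, hx, rfl⟩ _ ⟨y, hy, rfl⟩
    exact hφ hx.1 hy.1 (hx.2.trans hy.2).le)
  exact ⟨m, fun x hx hxc => hm ⟨x, ⟨hx, hxc⟩, rfl⟩, fun x hx hxc => hm' ⟨x, ⟨hx, hxc⟩, rfl⟩⟩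

lemma MonotoneOn.intervalIntegrable_of_diff_finite {φ : ℝ → ℝ} {u v : ℝ} {t : Set ℝ}
    (huv : u ≤ v) (ht : t.Finite) (hu : u ∉ t) (hv : v ∉ t)
    (hφ : MonotoneOn φ (Set.Icc u v \ t)) :
    IntervalIntegrable φ MeasureTheory.volume u v := by
  rw [intervalIntegrable_iff_integrableOn_Icc_of_le huv]
  have h : MeasureTheory.IntegrableOn φ (Set.Icc u v \ t) := by
    refine hφ.integrableOn_of_measure_ne_top (a := u) (b := v) ⟨⟨⟨le_rfl, huv⟩, hu⟩, ?_⟩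
      ⟨⟨⟨huv, le_rfl⟩, hv⟩, ?_⟩ ?_ (measurableSet_Icc.diff ht.measurableSet)
    · exact fun x hx => hx.1.1
    · exact fun x hx => hx.1.2
    · exact ((MeasureTheory.measure_mono Set.sdiff_subset).trans_lt measure_Icc_lt_top).ne
  exact h.congr_set_ae
    (MeasureTheory.sdiff_null_ae_eq_self (ht.measure_zero MeasureTheory.volume)).symm

lemma integral_quadInterp_add (f : ℝ → ℝ) (a m u v : ℝ) :
    ∫ x in u..v, (quadInterp f a x + m * (x * (x ^ 2 - a ^ 2))) =
      f 0 * (v - u) + (f a - f (-a)) / (2 * a) * ((v ^ 2 - u ^ 2) / 2) +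
      (f a + f (-a) - 2 * f 0) / (2 * a ^ 2) * ((v ^ 3 - u ^ 3) / 3) +
      m * ((v ^ 4 - u ^ 4) / 4 - a ^ 2 * ((v ^ 2 - u ^ 2) / 2)) := by
  unfold quadInterp
  generalize (f a - f (-a)) / (2 * a) = B
  generalize (f a + f (-a) - 2 * f 0) / (2 * a ^ 2) = C
  rw [intervalIntegral.integral_eq_sub_of_hasDerivAt (f := fun x => f 0 * x + B * (x ^ 2 / 2) +
    C * (x ^ 3 / 3) + m * (x ^ 4 / 4 - a ^ 2 * (x ^ 2 / 2)))]
  · ring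
  · intro x _
    have h (n : ℕ) := hasDerivAt_pow n x
    convert ((((hasDerivAt_id x).const_mul (f 0)).add (((h 2).div_const 2).const_mul B)).add
      (((h 3).div_const 3).const_mul C)).add
      ((((h 4).div_const 4).sub (((h 2).div_const 2).const_mul (a ^ 2))).const_mul m) using 1
    · ext y
      simp
    · push_cast
      ring
  · exact Continuous.intervalIntegrable (by fun_prop) _ _

/-- Proposition 3 (Chebyshev quadrature): for a `3`-convex function `f` on `[−1, 1]`,
`G₂(f) ≤ C(f) ≤ ∫_{−1}^{1} f`, where `G₂` is the 2-point Gauss–Legendre quadrature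
and `C` is the 3-point Chebyshev quadrature. -/
theorem gauss_le_chebyshev_le_integral
    (f : ℝ → ℝ) (hf : NConvexOn 3 (Set.Icc (-1) 1) f) :
    f (-(Real.sqrt 3 / 3)) + f (Real.sqrt 3 / 3) ≤
      2 / 3 * (f (-(Real.sqrt 2 / 2)) + f 0 + f (Real.sqrt 2 / 2)) ∧
    2 / 3 * (f (-(Real.sqrt 2 / 2)) + f 0 + f (Real.sqrt 2 / 2)) ≤
      ∫ t in (-1 : ℝ)..1, f t := by
  have ha2 : (Real.sqrt 2 / 2) ^ 2 = 1 / 2 := by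
    rw [div_pow, Real.sq_sqrt zero_le_two]; norm_num
  have hb2 : (Real.sqrt 3 / 3) ^ 2 = 1 / 3 := by
    rw [div_pow, Real.sq_sqrt zero_le_three]; norm_num
  have ha0 : 0 < Real.sqrt 2 / 2 := by positivity
  have hb0 : 0 < Real.sqrt 3 / 3 := by positivity
  generalize Real.sqrt 2 / 2 = a at *
  generalize Real.sqrt 3 / 3 = b at *
  have ha1 : a < 1 := by nlinarith
  have hba : b < a := by nlinarith
  have hane : a ≠ 0 := ha0.ne'
  have hmono := hf.monotoneOn_nodeQuotient hane (by
    simp only [Set.insert_subset_iff, Set.singleton_subset_iff, Set.mem_Icc]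
    refine ⟨⟨?_, ?_⟩, ⟨?_, ?_⟩, ?_, ?_⟩ <;> linarith)
  have hmem {x : ℝ} (h₁ : -1 ≤ x) (h₂ : x ≤ 1) (h₃ : x ≠ -a) (h₄ : x ≠ 0) (h₅ : x ≠ a) :
      x ∈ Set.Icc (-1) 1 \ {-a, 0, a} := ⟨⟨h₁, h₂⟩, by simp [h₃, h₄, h₅]⟩
  have hneg : (-1 : ℝ) ∈ Set.Icc (-1) 1 \ {-a, 0, a} := by
    apply hmem <;> linarith
  have hone : (1 : ℝ) ∈ Set.Icc (-1) 1 \ {-a, 0, a} := by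
    apply hmem <;> linarith
  constructor
  · have hle : nodeQuotient f a (-b) ≤ nodeQuotient f a b := by
      apply hmono _ _ (by linarith) <;> apply hmem <;> linarith
    rw [eq_quadInterp_add hane f b, eq_quadInterp_add hane f (-b)]
    simp only [quadInterp, neg_sq, ha2, hb2]
    nlinarith [mul_nonneg hb0.le (sub_nonneg.2 hle)]
  · have hint : IntervalIntegrable f MeasureTheory.volume (-1) 1 := by
      have h := hmono.intervalIntegrable_of_diff_finite (by norm_num)
        (Set.toFinite _) hneg.2 hone.2
      have hP : Continuous (quadInterp f a) := by unfold quadInterp; fun_prop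
      rw [funext (eq_quadInterp_add hane f)]
      exact (hP.intervalIntegrable _ _).add (h.continuousOn_mul (by fun_prop))
    obtain ⟨m, hm, hm'⟩ := hmono.exists_separator a ⟨-1, hneg, by simp; linarith⟩
      ⟨1, hone, ha1⟩
    obtain ⟨k, hk, hk'⟩ := hmono.exists_separator (-a) ⟨-1, hneg, by simpa using ha1⟩
      ⟨1, hone, by simp; linarith⟩
    have hright : ∀ x ∈ Set.Icc (0 : ℝ) 1,
        quadInterp f a x + m * (x * (x ^ 2 - a ^ 2)) ≤ f x := by
      rintro x ⟨hx0, hx1⟩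
      rw [eq_quadInterp_add hane f x, mul_comm m]
      refine add_le_add le_rfl ?_
      rcases hx0.eq_or_lt with rfl | hx0
      · simp
      rcases lt_trichotomy x a with h | rfl | h
      · exact mul_le_mul_of_nonpos_left
          (hm x (hmem (by linarith) hx1 (ne_of_gt (by linarith)) hx0.ne' h.ne) h)
          (mul_nonpos_of_nonneg_of_nonpos hx0.le (by nlinarith))
      · simp
      · exact mul_le_mul_of_nonneg_left
          (hm' x (hmem (by linarith) hx1 (ne_of_gt (by linarith)) hx0.ne' h.ne') h)
          (mul_nonneg hx0.le (by nlinarith))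
    have hleft : ∀ x ∈ Set.Icc (-1 : ℝ) 0,
        quadInterp f a x + k * (x * (x ^ 2 - a ^ 2)) ≤ f x := by
      rintro x ⟨hx1, hx0⟩
      rw [eq_quadInterp_add hane f x, mul_comm k]
      refine add_le_add le_rfl ?_
      rcases hx0.eq_or_lt with rfl | hx0
      · simp
      rcases lt_trichotomy x (-a) with h | rfl | h
      · exact mul_le_mul_of_nonpos_left
          (hk x (hmem hx1 (by linarith) h.ne hx0.ne (ne_of_lt (by linarith))) h)
          (mul_nonpos_of_nonpos_of_nonneg hx0.le (by nlinarith))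
      · simp
      · exact mul_le_mul_of_nonneg_left
          (hk' x (hmem hx1 (by linarith) h.ne' hx0.ne (ne_of_lt (by linarith))) h)
          (mul_nonneg_of_nonpos_of_nonpos hx0.le (by nlinarith))
    have hcont (n : ℝ) : Continuous fun x => quadInterp f a x + n * (x * (x ^ 2 - a ^ 2)) := by
      unfold quadInterp; fun_prop
    have hintl : IntervalIntegrable f MeasureTheory.volume (-1) 0 := hint.mono_set (by
      rw [Set.uIcc_of_le (by norm_num), Set.uIcc_of_le (by norm_num)]
      exact Set.Icc_subset_Icc le_rfl zero_le_one)
    have hintr : IntervalIntegrable f MeasureTheory.volume 0 1 := hint.mono_set (by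
      rw [Set.uIcc_of_le (by norm_num), Set.uIcc_of_le (by norm_num)]
      exact Set.Icc_subset_Icc (by norm_num) le_rfl)
    have h₁ := intervalIntegral.integral_mono_on (by norm_num)
      ((hcont k).intervalIntegrable _ _) hintl hleft
    have h₂ := intervalIntegral.integral_mono_on (by norm_num)
      ((hcont m).intervalIntegrable _ _) hintr hright
    rw [integral_quadInterp_add, ha2] at h₁ h₂
    rw [← intervalIntegral.integral_add_adjacent_intervals hintl hintr]
    linarith
end

section
/- If f : [−1, 1] → ℝ is 5-convex (any such f is Riemann integrable on [−1, 1]), then ∫_{−1}^{1} f(x) dx ≤ (2/5)·Smp(f) + (3/5)·G₂(f) ≤ Lob₄(f), where Smp(f) = (1/3)(f(−1) + 4f(0) + f(1)), G₂(f) = f(−√3/3) + f(√3/3), and Lob₄(f) = (1/6)(f(−1) + f(1)) + (5/6)(f(−√5/5) + f(√5/5)). -/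
/-- The divided difference of `f` over a finite set of nodes, in Lagrange form. -/
noncomputable def lagrangeDiff (f : ℝ → ℝ) (s : Finset ℝ) : ℝ :=
  ∑ w ∈ s, f w / ∏ y ∈ s.erase w, (w - y)

/-- The Lagrange interpolant of `f` over a finite set of nodes. -/
noncomputable def lagrangeInterp (f : ℝ → ℝ) (s : Finset ℝ) (x : ℝ) : ℝ :=
  ∑ w ∈ s, f w * ∏ y ∈ s.erase w, ((x - y) / (w - y))

/-- The nodal polynomial of a finite set of nodes. -/
noncomputable def nodalProd (s : Finset ℝ) (x : ℝ) : ℝ := ∏ y ∈ s, (x - y)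

lemma lagrangeDiff_erase (f : ℝ → ℝ) (s : Finset ℝ) {x : ℝ} (hx : x ∈ s) :
    lagrangeDiff f (s.erase x) = ∑ w ∈ s, f w * (w - x) / ∏ y ∈ s.erase w, (w - y) := by
  rw [lagrangeDiff, ← Finset.add_sum_erase s _ hx]
  simp only [sub_self, mul_zero, zero_div, zero_add]
  refine Finset.sum_congr rfl fun w hw => ?_
  have hwx : w ≠ x := Finset.ne_of_mem_erase hw
  rw [Finset.erase_right_comm,
    ← Finset.mul_prod_erase (s.erase w) _ (Finset.mem_erase.2 ⟨hwx.symm, hx⟩)]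
  rw [mul_comm (f w), mul_div_mul_left _ _ (sub_ne_zero.2 hwx)]

lemma lagrangeDiff_erase_sub_erase (f : ℝ → ℝ) (s : Finset ℝ) {x z : ℝ} (hx : x ∈ s)
    (hz : z ∈ s) (hxz : x ≠ z) :
    (lagrangeDiff f (s.erase x) - lagrangeDiff f (s.erase z)) / (z - x) = lagrangeDiff f s := by
  rw [lagrangeDiff_erase f s hx, lagrangeDiff_erase f s hz, ← Finset.sum_sub_distrib,
    div_eq_iff (sub_ne_zero.2 hxz.symm), lagrangeDiff, Finset.sum_mul]
  refine Finset.sum_congr rfl fun w _ => ?_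
  ring

lemma divDiff_eq_lagrangeDiff (f : ℝ → ℝ) :
    ∀ l : List ℝ, l.Nodup → divDiff f l = lagrangeDiff f l.toFinset
  | [], _ => by simp [divDiff, lagrangeDiff]
  | [x], _ => by simp [divDiff, lagrangeDiff]
  | x :: y :: l, h => by
    obtain ⟨m, z, hm⟩ : ∃ m z, y :: l = m ++ [z] :=
      ⟨_, _, (List.dropLast_append_getLast (List.cons_ne_nil y l)).symm⟩
    have hlen : (m ++ [z]).length = l.length + 1 := by rw [← hm]; simp
    have hn : (x :: (m ++ [z])).Nodup := hm ▸ h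
    have hn1 : (m ++ [z]).Nodup := hn.of_cons
    have hn2 : (x :: m).Nodup := by
      have : ((x :: m) ++ [z]).Nodup := by simpa using hn
      exact this.of_append_left
    have hx : x ∉ m ++ [z] := (List.nodup_cons.1 hn).1
    have hxz : x ≠ z := by
      rintro rfl
      simp at hx
    have hzm : z ∉ m := by
      intro hz
      exact (List.nodup_append.1 hn1).2.2 z hz z (by simp) rfl
    have e1 := divDiff_eq_lagrangeDiff f (m ++ [z]) hn1
    have e2 := divDiff_eq_lagrangeDiff f (x :: m) hn2
    rw [divDiff]
    simp only [hm, List.dropLast_concat, List.getLast_append_singleton]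
    rw [e1, e2, ← lagrangeDiff_erase_sub_erase f (x :: (m ++ [z])).toFinset (x := x) (z := z)
      (by simp) (by simp) hxz]
    congr 3
    · rw [List.toFinset_cons, Finset.erase_insert (by rwa [List.mem_toFinset])]
    · ext w
      simp only [List.toFinset_cons, List.toFinset_append, List.mem_toFinset, Finset.mem_insert,
        Finset.mem_erase, Finset.mem_union, List.toFinset_nil, Finset.notMem_empty]
      constructor
      · rintro (rfl | hw)
        · exact ⟨hxz, Or.inl rfl⟩
        · exact ⟨fun h => hzm (h ▸ hw), Or.inr (Or.inl hw)⟩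
      · tauto
termination_by l => l.length
decreasing_by
  all_goals simp at hlen ⊢
  all_goals omega

lemma NConvexOn.lagrangeDiff_nonneg {n : ℕ} {I : Set ℝ} {f : ℝ → ℝ} (hf : NConvexOn n I f)
    {s : Finset ℝ} (hs : s.card = n + 2) (hI : ∀ x ∈ s, x ∈ I) : 0 ≤ lagrangeDiff f s := by
  have h := hf s.toList (by simpa using hs) s.nodup_toList (by simpa using hI)
  rwa [divDiff_eq_lagrangeDiff f _ s.nodup_toList, Finset.toList_toFinset] at h

/-- For an `n`-convex function, the divided difference over `n` fixed nodes and one variable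
point is nondecreasing in that point. -/
lemma NConvexOn.monotoneOn_lagrangeDiff_insert {n : ℕ} {I : Set ℝ} {f : ℝ → ℝ}
    (hf : NConvexOn n I f) {s : Finset ℝ} (hs : s.card = n) (hI : ∀ x ∈ s, x ∈ I) :
    MonotoneOn (fun x => lagrangeDiff f (insert x s)) (I \ s) := by
  intro x hx y hy hxy
  rcases hxy.eq_or_lt with rfl | hlt
  · exact le_rfl
  have hx' : x ∉ s := by simpa using hx.2
  have hy' : y ∉ s := by simpa using hy.2
  have hxys : x ∉ insert y s := by simp [hlt.ne, hx']
  have h0 : 0 ≤ lagrangeDiff f (insert x (insert y s)) := by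
    refine hf.lagrangeDiff_nonneg ?_ ?_
    · rw [Finset.card_insert_of_notMem hxys, Finset.card_insert_of_notMem hy', hs]
    · simp only [Finset.mem_insert]
      rintro z (rfl | rfl | hz)
      exacts [hx.1, hy.1, hI z hz]
  rw [← lagrangeDiff_erase_sub_erase f _ (x := x) (z := y) (by simp) (by simp) hlt.ne,
    Finset.erase_insert hxys, Finset.insert_comm, Finset.erase_insert (by simp [hlt.ne', hy']),
    le_div_iff₀ (sub_pos.2 hlt), zero_mul] at h0
  exact sub_nonneg.1 h0

/-- Newton's form of the interpolation error. -/
lemma eq_lagrangeInterp_add (f : ℝ → ℝ) {s : Finset ℝ} {x : ℝ} (hx : x ∉ s) :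
    f x = lagrangeInterp f s x + nodalProd s x * lagrangeDiff f (insert x s) := by
  have hne : nodalProd s x ≠ 0 := by
    refine Finset.prod_ne_zero_iff.2 fun y hy => sub_ne_zero.2 ?_
    rintro rfl
    exact hx hy
  rw [lagrangeDiff, Finset.sum_insert hx, Finset.erase_insert hx, mul_add]
  change _ = _ + (_ * (f x / nodalProd s x) + _)
  rw [mul_div_cancel₀ _ hne, add_left_comm, left_eq_add, lagrangeInterp, Finset.mul_sum,
    ← Finset.sum_add_distrib]
  refine Finset.sum_eq_zero fun w hw => ?_
  have hwx : x ≠ w := by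
    rintro rfl
    exact hx hw
  rw [Finset.erase_insert_of_ne hwx, Finset.prod_insert (fun h => hx (Finset.mem_of_mem_erase h)),
    Finset.prod_div_distrib, nodalProd, ← Finset.mul_prod_erase s _ hw]
  have h1 : x - w ≠ 0 := sub_ne_zero.2 hwx
  have h2 : w - x ≠ 0 := sub_ne_zero.2 hwx.symm
  have h3 : ∏ y ∈ s.erase w, (w - y) ≠ 0 :=
    Finset.prod_ne_zero_iff.2 fun y hy => sub_ne_zero.2 (Finset.ne_of_mem_erase hy).symm
  field_simp
  ring

lemma continuous_lagrangeInterp (f : ℝ → ℝ) (s : Finset ℝ) : Continuous (lagrangeInterp f s) := by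
  unfold lagrangeInterp
  fun_prop

lemma continuous_nodalProd (s : Finset ℝ) : Continuous (nodalProd s) := by
  unfold nodalProd
  fun_prop

/-- If `K` is nondecreasing and `w` has the sign of `x` away from a central interval, then `w * K`
is bounded below by a multiple of `-|w|`. -/
lemma exists_neg_mul_abs_le_mul_of_monotoneOn {K w : ℝ → ℝ} {S : Set ℝ} {a b : ℝ}
    (hK : MonotoneOn K S) (ha : a ∈ S) (hb : b ∈ S) (hwa : ∀ x ∈ S, x ≤ a → w x ≤ 0)
    (hwb : ∀ x ∈ S, b ≤ x → 0 ≤ w x) :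
    ∃ C, ∀ x ∈ S, -(C * |w x|) ≤ w x * K x := by
  refine ⟨|K a| + |K b|, fun x hx => ?_⟩
  have hC : 0 ≤ |K a| + |K b| := by positivity
  have key1 : 0 ≤ w x → -(|K a| + |K b|) ≤ K x → -((|K a| + |K b|) * |w x|) ≤ w x * K x := by
    intro h0 h1
    rw [abs_of_nonneg h0]
    nlinarith
  have key2 : w x ≤ 0 → K x ≤ |K a| + |K b| → -((|K a| + |K b|) * |w x|) ≤ w x * K x := by
    intro h0 h1
    rw [abs_of_nonpos h0]
    nlinarith
  rcases le_total x a with hxa | hxa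
  · refine key2 (hwa x hx hxa) ((hK hx ha hxa).trans ?_)
    linarith [le_abs_self (K a), abs_nonneg (K b)]
  · have hl : -(|K a| + |K b|) ≤ K x :=
      le_trans (by linarith [neg_abs_le (K a), abs_nonneg (K b)]) (hK ha hx hxa)
    rcases le_total b x with hxb | hxb
    · exact key1 (hwb x hx hxb) hl
    · rcases le_total 0 (w x) with h | h
      · exact key1 h hl
      · exact key2 h ((hK hx hb hxb).trans (by linarith [le_abs_self (K b), abs_nonneg (K a)]))

open MeasureTheory in
lemma NConvexOn.aemeasurable {n : ℕ} {I : Set ℝ} {f : ℝ → ℝ} (hI : MeasurableSet I)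
    (hf : NConvexOn n I f) {s : Finset ℝ} (hs : s.card = n) (hsI : ∀ x ∈ s, x ∈ I) :
    AEMeasurable f (volume.restrict I) := by
  have hm : MeasurableSet (I \ (s : Set ℝ)) := hI.diff s.measurableSet
  have hr : volume.restrict (I \ (s : Set ℝ)) = volume.restrict I :=
    Measure.restrict_congr_set (sdiff_null_ae_eq_self (s.finite_toSet.measure_zero volume))
  have hK := aemeasurable_restrict_of_monotoneOn (μ := volume) hm
    (hf.monotoneOn_lagrangeDiff_insert hs hsI)
  rw [← hr]
  refine AEMeasurable.congr ((continuous_lagrangeInterp f s).aemeasurable.add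
    ((continuous_nodalProd s).aemeasurable.mul hK)) ?_
  filter_upwards [ae_restrict_mem hm] with x hx
  exact (eq_lagrangeInterp_add f (by simpa using hx.2)).symm

lemma nodalProd_eq (a b c d e x : ℝ) (hab : a ∉ ({b, c, d, e} : Finset ℝ))
    (hbc : b ∉ ({c, d, e} : Finset ℝ)) (hcd : c ∉ ({d, e} : Finset ℝ)) (hde : d ≠ e) :
    nodalProd {a, b, c, d, e} x = (x - a) * (x - b) * (x - c) * (x - d) * (x - e) := by
  rw [nodalProd, Finset.prod_insert hab, Finset.prod_insert hbc, Finset.prod_insert hcd,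
    Finset.prod_pair hde]
  ring

open MeasureTheory in
lemma NConvexOn.integrableOn {f : ℝ → ℝ} (hf : NConvexOn 5 (Set.Icc (-1) 1) f) :
    IntegrableOn f (Set.Icc (-1) 1) := by
  set s : Finset ℝ := {-(1 / 2), -(1 / 4), 0, 1 / 4, 1 / 2} with hsdef
  set t : Finset ℝ := {-1, -(1 / 2), 0, 1 / 2, 1} with htdef
  have hs : s.card = 5 := by norm_num [hsdef, Finset.card_insert_of_notMem]
  have ht : t.card = 5 := by norm_num [htdef, Finset.card_insert_of_notMem]
  have hsI : ∀ x ∈ s, x ∈ Set.Icc (-1 : ℝ) 1 := by norm_num [hsdef]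
  have htI : ∀ x ∈ t, x ∈ Set.Icc (-1 : ℝ) 1 := by norm_num [htdef]
  have hsw : ∀ x, nodalProd s x = x * (x ^ 2 - 1 / 16) * (x ^ 2 - 1 / 4) := by
    intro x
    rw [hsdef, nodalProd_eq] <;> norm_num
    ring
  have htw : ∀ x, nodalProd t x = x * (x ^ 2 - 1 / 4) * (x ^ 2 - 1) := by
    intro x
    rw [htdef, nodalProd_eq] <;> norm_num
    ring
  have hKs := hf.monotoneOn_lagrangeDiff_insert hs hsI
  have hKt := hf.monotoneOn_lagrangeDiff_insert ht htI
  obtain ⟨C, hC⟩ : ∃ C, ∀ x ∈ Set.Icc (-1 : ℝ) 1 \ s,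
      lagrangeInterp f s x - C * |nodalProd s x| ≤ f x := by
    obtain ⟨C, hC⟩ := exists_neg_mul_abs_le_mul_of_monotoneOn (w := nodalProd s)
      (a := -(3 / 4)) (b := 3 / 4) hKs (by norm_num [hsdef]) (by norm_num [hsdef])
      (fun y hy hya => by
        rw [hsw, mul_assoc]
        exact mul_nonpos_of_nonpos_of_nonneg (by linarith)
          (mul_nonneg (by nlinarith) (by nlinarith)))
      (fun y hy hya => by
        rw [hsw, mul_assoc]
        exact mul_nonneg (by linarith) (mul_nonneg (by nlinarith) (by nlinarith)))
    refine ⟨C, fun x hx => ?_⟩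
    have := hC x hx
    rw [eq_lagrangeInterp_add f (by simpa using hx.2 : x ∉ s)]
    linarith
  obtain ⟨D, hD⟩ : ∃ D, ∀ x ∈ Set.Icc (-1 : ℝ) 1 \ t,
      f x ≤ lagrangeInterp f t x + D * |nodalProd t x| := by
    obtain ⟨D, hD⟩ := exists_neg_mul_abs_le_mul_of_monotoneOn (w := fun x => -nodalProd t x)
      (a := -(3 / 4)) (b := 3 / 4) hKt (by norm_num [htdef]) (by norm_num [htdef])
      (fun y hy hya => by
        rw [htw, mul_assoc, ← mul_neg, ← mul_neg]
        exact mul_nonpos_of_nonpos_of_nonneg (by linarith)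
          (mul_nonneg (by nlinarith) (by nlinarith [hy.1.1, hy.1.2])))
      (fun y hy hya => by
        rw [htw, mul_assoc, ← mul_neg, ← mul_neg]
        exact mul_nonneg (by linarith)
          (mul_nonneg (by nlinarith) (by nlinarith [hy.1.1, hy.1.2])))
    refine ⟨D, fun x hx => ?_⟩
    have := hD x hx
    rw [abs_neg] at this
    rw [eq_lagrangeInterp_add f (by simpa using hx.2 : x ∉ t)]
    linarith
  have cl : Continuous fun x => lagrangeInterp f s x - C * |nodalProd s x| :=
    (continuous_lagrangeInterp f s).sub (continuous_const.mul (continuous_nodalProd s).abs)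
  have cu : Continuous fun x => lagrangeInterp f t x + D * |nodalProd t x| :=
    (continuous_lagrangeInterp f t).add (continuous_const.mul (continuous_nodalProd t).abs)
  have hnull : ∀ u : Finset ℝ, ∀ᵐ x ∂volume.restrict (Set.Icc (-1 : ℝ) 1), x ∉ u := fun u =>
    ae_restrict_of_ae (by simpa using u.countable_toSet.ae_notMem volume)
  refine integrable_of_le_of_le
    (hf.aemeasurable measurableSet_Icc hs hsI).aestronglyMeasurable ?_ ?_
    (cl.integrableOn_Icc) (cu.integrableOn_Icc)
  · filter_upwards [hnull s, ae_restrict_mem measurableSet_Icc] with x hx hxI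
    exact hC x ⟨hxI, by simpa using hx⟩
  · filter_upwards [hnull t, ae_restrict_mem measurableSet_Icc] with x hx hxI
    exact hD x ⟨hxI, by simpa using hx⟩

/-- A nondecreasing function on the complement of a point can be compared with a constant. -/
lemma exists_le_and_ge_of_monotoneOn {D : ℝ → ℝ} {l a r : ℝ} (hla : l < a) (har : a < r)
    (hD : MonotoneOn D (Set.Ioo l a ∪ Set.Ioo a r)) :
    ∃ c, (∀ x ∈ Set.Ioo l a, D x ≤ c) ∧ ∀ x ∈ Set.Ioo a r, c ≤ D x := by
  have key : ∀ x ∈ Set.Ioo a r, ∀ y ∈ Set.Ioo l a, D y ≤ D x := fun x hx y hy =>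
    hD (Or.inl hy) (Or.inr hx) (hy.2.trans hx.1).le
  obtain ⟨z, hz⟩ := Set.nonempty_Ioo.2 har
  have hne : (D '' Set.Ioo l a).Nonempty := (Set.nonempty_Ioo.2 hla).image D
  refine ⟨sSup (D '' Set.Ioo l a), fun x hx => le_csSup ⟨D z, ?_⟩ (Set.mem_image_of_mem D hx),
    fun x hx => csSup_le hne ?_⟩
  · exact Set.forall_mem_image.2 (key z hz)
  · exact Set.forall_mem_image.2 (key x hx)

lemma notMem_symmetric_nodes {a : ℝ} (ha0 : 0 < a) (ha1 : a < 1) :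
    (-1 : ℝ) ∉ ({-a, 0, a, 1} : Finset ℝ) ∧ -a ∉ ({0, a, 1} : Finset ℝ) ∧
      (0 : ℝ) ∉ ({a, 1} : Finset ℝ) := by
  simp only [Finset.mem_insert, Finset.mem_singleton, not_or]
  refine ⟨⟨?_, ?_, ?_, ?_⟩, ⟨?_, ?_, ?_⟩, ?_, ?_⟩ <;> intro h <;> linarith

lemma lagrangeInterp_add_neg (f : ℝ → ℝ) {a : ℝ} (ha0 : 0 < a) (ha1 : a < 1) (x : ℝ) :
    lagrangeInterp f {-1, -a, 0, a, 1} x + lagrangeInterp f {-1, -a, 0, a, 1} (-x) =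
      2 * f 0 * ((x ^ 2 - a ^ 2) * (x ^ 2 - 1) / a ^ 2) +
      (f (-a) + f a) * (x ^ 2 * (x ^ 2 - 1) / (a ^ 2 * (a ^ 2 - 1))) +
      (f (-1) + f 1) * (x ^ 2 * (x ^ 2 - a ^ 2) / (1 - a ^ 2)) := by
  obtain ⟨h1, h2, h3⟩ := notMem_symmetric_nodes ha0 ha1
  have h4 : a ∉ ({1} : Finset ℝ) := by simpa using ha1.ne
  have n1 : a ≠ 0 := ha0.ne'
  have d1 : (-1 : ℝ) ≠ a := by linarith
  have d2 : (-1 : ℝ) ≠ -a := by intro h; linarith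
  have d3 : (-a : ℝ) ≠ 1 := by linarith
  have d5 : (-1 : ℝ) ≠ 1 := by norm_num
  have d4 : (-a : ℝ) ≠ a := by linarith
  have n4 : 1 - a ≠ 0 := by linarith
  have n5 : 1 + a ≠ 0 := by linarith
  have he : ∀ w z : ℝ, ∏ y ∈ ({-1, -a, 0, a, 1} : Finset ℝ).erase w, ((z - y) / (w - y)) =
      ∏ y ∈ ({-1, -a, 0, a, 1} : Finset ℝ), if y ≠ w then (z - y) / (w - y) else 1 := by
    intro w z
    rw [← Finset.prod_filter, Finset.filter_ne']
  simp only [lagrangeInterp, he, Finset.sum_insert h1, Finset.sum_insert h2, Finset.sum_insert h3,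
    Finset.sum_insert h4, Finset.sum_singleton, Finset.prod_insert h1, Finset.prod_insert h2,
    Finset.prod_insert h3, Finset.prod_insert h4, Finset.prod_singleton]
  simp [d1, d2, d3, d4, d1.symm, d2.symm, d3.symm, d4.symm, n1, n1.symm, ha1.ne, ha1.ne', d5,
    d5.symm]
  have f1 : (-1 : ℝ) - a = -(1 + a) := by ring
  have f2 : (-1 : ℝ) + a = -(1 - a) := by ring
  have f3 : -a + 1 = 1 - a := by ring
  have f4 : -a - 1 = -(1 + a) := by ring
  have f5 : a - 1 = -(1 - a) := by ring
  have f6 : a + 1 = 1 + a := by ring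
  have f7 : -a - a = -(2 * a) := by ring
  have f8 : a + a = 2 * a := by ring
  have f9 : 1 - a ^ 2 = (1 - a) * (1 + a) := by ring
  have f10 : a ^ 2 - 1 = -((1 - a) * (1 + a)) := by ring
  rw [f1, f2, f3, f4, f5, f6, f7, f8, f9, f10]
  field_simp
  ring

lemma nodalProd_symmetric {a : ℝ} (ha0 : 0 < a) (ha1 : a < 1) (x : ℝ) :
    nodalProd {-1, -a, 0, a, 1} x = x * (x ^ 2 - a ^ 2) * (x ^ 2 - 1) := by
  obtain ⟨h1, h2, h3⟩ := notMem_symmetric_nodes ha0 ha1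
  rw [nodalProd_eq _ _ _ _ _ _ h1 h2 h3 ha1.ne]
  ring

/-- The even part of a `5`-convex function is an even interpolant plus an odd nodal polynomial
times a nonnegative nondecreasing function. -/
lemma NConvexOn.exists_add_neg_eq {f : ℝ → ℝ} (hf : NConvexOn 5 (Set.Icc (-1) 1) f) {a : ℝ}
    (ha0 : 0 < a) (ha1 : a < 1) :
    ∃ D : ℝ → ℝ, MonotoneOn D (Set.Ioo 0 a ∪ Set.Ioo a 1) ∧
      ∀ x ∈ Set.Ioo 0 a ∪ Set.Ioo a 1, 0 ≤ D x ∧ f x + f (-x) =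
        2 * f 0 * ((x ^ 2 - a ^ 2) * (x ^ 2 - 1) / a ^ 2) +
        (f (-a) + f a) * (x ^ 2 * (x ^ 2 - 1) / (a ^ 2 * (a ^ 2 - 1))) +
        (f (-1) + f 1) * (x ^ 2 * (x ^ 2 - a ^ 2) / (1 - a ^ 2)) +
        x * (x ^ 2 - a ^ 2) * (x ^ 2 - 1) * D x := by
  set s : Finset ℝ := {-1, -a, 0, a, 1} with hsdef
  have hs : s.card = 5 := by
    obtain ⟨h1, h2, h3⟩ := notMem_symmetric_nodes ha0 ha1
    rw [hsdef, Finset.card_insert_of_notMem h1, Finset.card_insert_of_notMem h2,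
      Finset.card_insert_of_notMem h3, Finset.card_pair ha1.ne]
  have hsI : ∀ x ∈ s, x ∈ Set.Icc (-1 : ℝ) 1 := by
    simp only [hsdef, Finset.mem_insert, Finset.mem_singleton]
    intro x hx
    rcases hx with h | h | h | h | h <;> constructor <;> linarith
  have hK := hf.monotoneOn_lagrangeDiff_insert hs hsI
  have hmem : ∀ x ∈ Set.Ioo 0 a ∪ Set.Ioo a 1,
      x ∈ Set.Icc (-1 : ℝ) 1 \ s ∧ -x ∈ Set.Icc (-1 : ℝ) 1 \ s := by
    simp only [hsdef, Finset.coe_insert, Finset.coe_singleton, Set.mem_sdiff, Set.mem_insert_iff,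
      Set.mem_singleton_iff, Set.mem_Icc]
    rintro x (hx | hx) <;> obtain ⟨h1, h2⟩ := hx <;>
      refine ⟨⟨⟨by linarith, by linarith⟩, ?_⟩, ⟨⟨by linarith, by linarith⟩, ?_⟩⟩ <;>
      rintro (h | h | h | h | h) <;> linarith
  have hpos : ∀ x ∈ Set.Ioo 0 a ∪ Set.Ioo a 1, 0 < x := by
    rintro x (hx | hx)
    exacts [hx.1, ha0.trans hx.1]
  refine ⟨fun x => lagrangeDiff f (insert x s) - lagrangeDiff f (insert (-x) s), ?_, ?_⟩
  · intro x hx y hy hxy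
    exact sub_le_sub (hK (hmem x hx).1 (hmem y hy).1 hxy)
      (hK (hmem y hy).2 (hmem x hx).2 (neg_le_neg hxy))
  · intro x hx
    refine ⟨sub_nonneg.2 (hK (hmem x hx).2 (hmem x hx).1 (by linarith [hpos x hx])), ?_⟩
    rw [← lagrangeInterp_add_neg f ha0 ha1 x,
      eq_lagrangeInterp_add f (by simpa using (hmem x hx).1.2 : x ∉ s),
      eq_lagrangeInterp_add f (by simpa using (hmem x hx).2.2 : -x ∉ s), hsdef,
      nodalProd_symmetric ha0 ha1, nodalProd_symmetric ha0 ha1]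
    ring

open MeasureTheory in
lemma NConvexOn.integral_le {f : ℝ → ℝ} (hf : NConvexOn 5 (Set.Icc (-1) 1) f) {a : ℝ}
    (ha0 : 0 < a) (ha : a ^ 2 = 1 / 3) :
    (∫ t in (-1 : ℝ)..1, f t) ≤
      2 / 5 * (1 / 3 * (f (-1) + 4 * f 0 + f 1)) + 3 / 5 * (f (-a) + f a) := by
  have ha1 : a < 1 := by nlinarith
  obtain ⟨D, hD, hfD⟩ := hf.exists_add_neg_eq ha0 ha1
  obtain ⟨c, hc1, hc2⟩ := exists_le_and_ge_of_monotoneOn ha0 ha1 hD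
  have hle : ∀ x ∈ Set.Ioo 0 a ∪ Set.Ioo a 1, f x + f (-x) ≤
      6 * f 0 * (x ^ 4 - 4 / 3 * x ^ 2 + 1 / 3) + (f (-a) + f a) * (9 / 2 * (x ^ 2 - x ^ 4)) +
        (f (-1) + f 1) * (3 / 2 * (x ^ 4 - 1 / 3 * x ^ 2)) +
        c * (x ^ 5 - 4 / 3 * x ^ 3 + 1 / 3 * x) := by
    intro x hx
    have hw : x * (x ^ 2 - 1 / 3) * (x ^ 2 - 1) * (D x - c) ≤ 0 := by
      rw [← ha]
      rcases hx with hx | hx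
      · refine mul_nonpos_of_nonneg_of_nonpos ?_ (sub_nonpos.2 (hc1 x hx))
        rw [mul_assoc]
        exact mul_nonneg hx.1.le (mul_nonneg_of_nonpos_of_nonpos (by nlinarith [hx.1, hx.2])
          (by nlinarith [hx.1, hx.2]))
      · refine mul_nonpos_of_nonpos_of_nonneg ?_ (sub_nonneg.2 (hc2 x hx))
        rw [mul_assoc]
        exact mul_nonpos_of_nonneg_of_nonpos (ha0.trans hx.1).le
          (mul_nonpos_of_nonneg_of_nonpos (by nlinarith [hx.1, hx.2])
          (by nlinarith [hx.1, hx.2]))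
    rw [(hfD x hx).2, ha]
    ring_nf at hw ⊢
    linarith
  have hint : IntervalIntegrable f volume (-1) 1 :=
    (intervalIntegrable_iff_integrableOn_Icc_of_le (by norm_num)).2 hf.integrableOn
  have hi1 : IntervalIntegrable f volume (-1) 0 :=
    hint.mono_set (by
      rw [Set.uIcc_of_le (by norm_num), Set.uIcc_of_le (by norm_num)]
      exact Set.Icc_subset_Icc_right (by norm_num))
  have hi2 : IntervalIntegrable f volume 0 1 :=
    hint.mono_set (by
      rw [Set.uIcc_of_le (by norm_num), Set.uIcc_of_le (by norm_num)]
      exact Set.Icc_subset_Icc_left (by norm_num))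
  have hi1' : IntervalIntegrable (fun x => f (-x)) volume 0 1 := by
    simpa using (hi1.comp_sub_left 0).symm
  have hneg : (∫ t in (-1 : ℝ)..0, f t) = ∫ t in (0 : ℝ)..1, f (-t) := by
    simp [intervalIntegral.integral_comp_neg]
  rw [← intervalIntegral.integral_add_adjacent_intervals hi1 hi2, hneg, add_comm,
    ← intervalIntegral.integral_add hi2 hi1']
  have hcont : Continuous fun x : ℝ =>
      6 * f 0 * (x ^ 4 - 4 / 3 * x ^ 2 + 1 / 3) + (f (-a) + f a) * (9 / 2 * (x ^ 2 - x ^ 4)) +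
        (f (-1) + f 1) * (3 / 2 * (x ^ 4 - 1 / 3 * x ^ 2)) +
        c * (x ^ 5 - 4 / 3 * x ^ 3 + 1 / 3 * x) := by
    fun_prop
  refine (intervalIntegral.integral_mono_ae_restrict zero_le_one (hi2.add hi1')
    (hcont.intervalIntegrable 0 1) ?_).trans_eq ?_
  · filter_upwards [ae_restrict_mem measurableSet_Icc,
      ae_restrict_of_ae (({0, a, 1} : Finset ℝ).countable_toSet.ae_notMem volume)] with x hx hxn
    simp only [Finset.coe_insert, Finset.coe_singleton, Set.mem_insert_iff,
      Set.mem_singleton_iff, not_or] at hxn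
    refine hle x ?_
    have h0 : 0 < x := lt_of_le_of_ne hx.1 (Ne.symm hxn.1)
    have h1 : x < 1 := lt_of_le_of_ne hx.2 hxn.2.2
    rcases lt_or_gt_of_ne hxn.2.1 with h | h
    exacts [Or.inl ⟨h0, h⟩, Or.inr ⟨h, h1⟩]
  · have hprim : ∀ x ∈ Set.uIcc (0 : ℝ) 1, HasDerivAt (fun x : ℝ =>
        6 * f 0 * (x ^ 5 / 5 - 4 / 9 * x ^ 3 + 1 / 3 * x) +
        (f (-a) + f a) * (9 / 2 * (x ^ 3 / 3 - x ^ 5 / 5)) +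
        (f (-1) + f 1) * (3 / 2 * (x ^ 5 / 5 - 1 / 9 * x ^ 3)) +
        c * (x ^ 6 / 6 - 1 / 3 * x ^ 4 + 1 / 6 * x ^ 2))
        (6 * f 0 * (x ^ 4 - 4 / 3 * x ^ 2 + 1 / 3) + (f (-a) + f a) * (9 / 2 * (x ^ 2 - x ^ 4)) +
        (f (-1) + f 1) * (3 / 2 * (x ^ 4 - 1 / 3 * x ^ 2)) +
        c * (x ^ 5 - 4 / 3 * x ^ 3 + 1 / 3 * x)) x := by
      intro x _
      have p := fun n : ℕ => hasDerivAt_pow n x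
      have := ((((((p 5).div_const 5).sub ((p 3).const_mul (4 / 9))).add
        ((hasDerivAt_id x).const_mul (1 / 3))).const_mul (6 * f 0)).add
        ((((p 3).div_const 3).sub ((p 5).div_const 5)).const_mul (9 / 2) |>.const_mul
          (f (-a) + f a))).add
        ((((p 5).div_const 5).sub ((p 3).const_mul (1 / 9))).const_mul (3 / 2) |>.const_mul
          (f (-1) + f 1)) |>.add
        (((((p 6).div_const 6).sub ((p 4).const_mul (1 / 3))).add
          ((p 2).const_mul (1 / 6))).const_mul c)
      refine this.congr_deriv ?_
      norm_num
      ring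
    rw [intervalIntegral.integral_eq_sub_of_hasDerivAt hprim (hcont.intervalIntegrable 0 1)]
    norm_num
    ring

lemma NConvexOn.mixed_le_lobatto {f : ℝ → ℝ} (hf : NConvexOn 5 (Set.Icc (-1) 1) f) {a b : ℝ}
    (ha0 : 0 < a) (ha : a ^ 2 = 1 / 3) (hb0 : 0 < b) (hb : b ^ 2 = 1 / 5) :
    2 / 5 * (1 / 3 * (f (-1) + 4 * f 0 + f 1)) + 3 / 5 * (f (-a) + f a) ≤
      1 / 6 * (f (-1) + f 1) + 5 / 6 * (f (-b) + f b) := by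
  have ha1 : a < 1 := by nlinarith
  have hba : b < a := by nlinarith
  obtain ⟨D, -, hfD⟩ := hf.exists_add_neg_eq ha0 ha1
  obtain ⟨hD0, hD⟩ := hfD b (Or.inl ⟨hb0, hba⟩)
  rw [ha, hb] at hD
  have := mul_nonneg hb0.le hD0
  linarith

/-- Proposition 4: for a `5`-convex function `f` on `[−1, 1]`,
`∫_{−1}^{1} f ≤ (2/5)·Smp(f) + (3/5)·G₂(f) ≤ Lob₄(f)`, where `Smp` is Simpson's
quadrature, `G₂` the 2-point Gauss–Legendre quadrature and `Lob₄` the 4-point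
Lobatto quadrature. -/
theorem integral_le_mixed_le_lobatto
    (f : ℝ → ℝ) (hf : NConvexOn 5 (Set.Icc (-1) 1) f) :
    (∫ t in (-1 : ℝ)..1, f t) ≤
      2 / 5 * (1 / 3 * (f (-1) + 4 * f 0 + f 1)) +
        3 / 5 * (f (-(Real.sqrt 3 / 3)) + f (Real.sqrt 3 / 3)) ∧
    2 / 5 * (1 / 3 * (f (-1) + 4 * f 0 + f 1)) +
        3 / 5 * (f (-(Real.sqrt 3 / 3)) + f (Real.sqrt 3 / 3)) ≤
      1 / 6 * (f (-1) + f 1) +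
        5 / 6 * (f (-(Real.sqrt 5 / 5)) + f (Real.sqrt 5 / 5)) := by
  have h3 : (Real.sqrt 3 / 3) ^ 2 = 1 / 3 := by
    rw [div_pow, Real.sq_sqrt (by norm_num)]
    norm_num
  have h5 : (Real.sqrt 5 / 5) ^ 2 = 1 / 5 := by
    rw [div_pow, Real.sq_sqrt (by norm_num)]
    norm_num
  exact ⟨hf.integral_le (by positivity) h3,
    hf.mixed_le_lobatto (by positivity) h3 (by positivity) h5⟩
end

section
/- Let f : [−1, 1] → ℝ be six times continuously differentiable and let M = sup{ |f⁽⁶⁾(x)| : x ∈ [−1, 1] }. Then |T(f) − ∫_{−1}^{1} f(x) dx| ≤ M/28350, where T(f) = (2/5)·(1/3)(f(−1) + 4f(0) + f(1)) + (3/5)·(f(−√3/3) + f(√3/3)). -/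
open Set intervalIntegral

/-- Sixfold integration by parts against the polynomial `c 0 + c 1 * t + ⋯ + c 6 * t ^ 6`. -/
theorem integral_sextic_mul_sixth_deriv {h : ℕ → ℝ → ℝ} {a b : ℝ} (hab : a ≤ b) (c : ℕ → ℝ)
    (hc : ∀ k ≤ 6, ContinuousOn (h k) (Icc a b))
    (hd : ∀ k < 6, ∀ x ∈ Ioo a b, HasDerivAt (h k) (h (k + 1) x) x)
    (p p₁ p₂ p₃ p₄ p₅ : ℝ → ℝ)
    (hp : p = fun t => c 0 + c 1 * t + c 2 * t ^ 2 + c 3 * t ^ 3 + c 4 * t ^ 4 + c 5 * t ^ 5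
      + c 6 * t ^ 6)
    (hp₁ : p₁ = fun t => c 1 + 2 * c 2 * t + 3 * c 3 * t ^ 2 + 4 * c 4 * t ^ 3 + 5 * c 5 * t ^ 4
      + 6 * c 6 * t ^ 5)
    (hp₂ : p₂ = fun t => 2 * c 2 + 6 * c 3 * t + 12 * c 4 * t ^ 2 + 20 * c 5 * t ^ 3
      + 30 * c 6 * t ^ 4)
    (hp₃ : p₃ = fun t => 6 * c 3 + 24 * c 4 * t + 60 * c 5 * t ^ 2 + 120 * c 6 * t ^ 3)
    (hp₄ : p₄ = fun t => 24 * c 4 + 120 * c 5 * t + 360 * c 6 * t ^ 2)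
    (hp₅ : p₅ = fun t => 120 * c 5 + 720 * c 6 * t) :
    ∫ t in a..b, p t * h 6 t =
      (p b * h 5 b - p₁ b * h 4 b + p₂ b * h 3 b - p₃ b * h 2 b + p₄ b * h 1 b - p₅ b * h 0 b) -
      (p a * h 5 a - p₁ a * h 4 a + p₂ a * h 3 a - p₃ a * h 2 a + p₄ a * h 1 a - p₅ a * h 0 a) +
      720 * c 6 * ∫ t in a..b, h 0 t := by
  have d0 : ∀ x, HasDerivAt p (p₁ x) x := by
    intro x
    have := (((((((hasDerivAt_const x (c 0)).add ((hasDerivAt_id x).const_mul (c 1))).add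
      ((hasDerivAt_pow 2 x).const_mul (c 2))).add ((hasDerivAt_pow 3 x).const_mul (c 3))).add
      ((hasDerivAt_pow 4 x).const_mul (c 4))).add ((hasDerivAt_pow 5 x).const_mul (c 5))).add
      ((hasDerivAt_pow 6 x).const_mul (c 6)))
    rw [hp, hp₁]
    refine this.congr_deriv ?_
    norm_num; ring
  have d1 : ∀ x, HasDerivAt p₁ (p₂ x) x := by
    intro x
    have := ((((((hasDerivAt_const x (c 1)).add ((hasDerivAt_id x).const_mul (2 * c 2))).add
      ((hasDerivAt_pow 2 x).const_mul (3 * c 3))).add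
      ((hasDerivAt_pow 3 x).const_mul (4 * c 4))).add
      ((hasDerivAt_pow 4 x).const_mul (5 * c 5))).add
      ((hasDerivAt_pow 5 x).const_mul (6 * c 6)))
    rw [hp₁, hp₂]
    refine this.congr_deriv ?_
    norm_num; ring
  have d2 : ∀ x, HasDerivAt p₂ (p₃ x) x := by
    intro x
    have := (((((hasDerivAt_const x (2 * c 2)).add ((hasDerivAt_id x).const_mul (6 * c 3))).add
      ((hasDerivAt_pow 2 x).const_mul (12 * c 4))).add
      ((hasDerivAt_pow 3 x).const_mul (20 * c 5))).add
      ((hasDerivAt_pow 4 x).const_mul (30 * c 6)))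
    rw [hp₂, hp₃]
    refine this.congr_deriv ?_
    norm_num; ring
  have d3 : ∀ x, HasDerivAt p₃ (p₄ x) x := by
    intro x
    have := ((((hasDerivAt_const x (6 * c 3)).add ((hasDerivAt_id x).const_mul (24 * c 4))).add
      ((hasDerivAt_pow 2 x).const_mul (60 * c 5))).add
      ((hasDerivAt_pow 3 x).const_mul (120 * c 6)))
    rw [hp₃, hp₄]
    refine this.congr_deriv ?_
    norm_num; ring
  have d4 : ∀ x, HasDerivAt p₄ (p₅ x) x := by
    intro x
    have := (((hasDerivAt_const x (24 * c 4)).add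
      ((hasDerivAt_id x).const_mul (120 * c 5))).add ((hasDerivAt_pow 2 x).const_mul (360 * c 6)))
    rw [hp₄, hp₅]
    refine this.congr_deriv ?_
    norm_num; ring
  have d5 : ∀ x, HasDerivAt p₅ (720 * c 6) x := by
    intro x
    have := (hasDerivAt_const x (120 * c 5)).add ((hasDerivAt_id x).const_mul (720 * c 6))
    rw [hp₅]
    refine this.congr_deriv ?_
    norm_num
  have cont : ∀ {q q' : ℝ → ℝ}, (∀ x, HasDerivAt q (q' x) x) → ContinuousOn q (Icc a b) :=
    fun hq x _ => (hq x).continuousAt.continuousWithinAt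
  have i6 : IntervalIntegrable (fun t => p t * h 6 t) MeasureTheory.volume a b :=
    ((cont d0).mul (hc 6 le_rfl)).intervalIntegrable_of_Icc hab
  have i0 : IntervalIntegrable (fun t => 720 * c 6 * h 0 t) MeasureTheory.volume a b :=
    (continuousOn_const.mul (hc 0 (by norm_num))).intervalIntegrable_of_Icc hab
  have key := integral_eq_sub_of_hasDerivAt_of_le
    (f := fun t => p t * h 5 t - p₁ t * h 4 t + p₂ t * h 3 t - p₃ t * h 2 t + p₄ t * h 1 t
      - p₅ t * h 0 t)
    (f' := fun t => p t * h 6 t - 720 * c 6 * h 0 t) hab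
    (((((((cont d0).mul (hc 5 (by norm_num))).sub ((cont d1).mul (hc 4 (by norm_num)))).add
      ((cont d2).mul (hc 3 (by norm_num)))).sub ((cont d3).mul (hc 2 (by norm_num)))).add
      ((cont d4).mul (hc 1 (by norm_num)))).sub ((cont d5).mul (hc 0 (by norm_num))))
    (fun x hx => by
      refine (((((((d0 x).mul (hd 5 (by norm_num) x hx)).sub
        ((d1 x).mul (hd 4 (by norm_num) x hx))).add
        ((d2 x).mul (hd 3 (by norm_num) x hx))).sub ((d3 x).mul (hd 2 (by norm_num) x hx))).add
        ((d4 x).mul (hd 1 (by norm_num) x hx))).sub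
        ((d5 x).mul (hd 0 (by norm_num) x hx))).congr_deriv ?_
      norm_num
      ring)
    (i6.sub i0)
  rw [integral_sub i6 i0, integral_const_mul] at key
  linarith

theorem integral_sextic (a b : ℝ) (c : ℕ → ℝ) :
    ∫ t in a..b, (c 0 + c 1 * t + c 2 * t ^ 2 + c 3 * t ^ 3 + c 4 * t ^ 4 + c 5 * t ^ 5
      + c 6 * t ^ 6) =
    c 0 * (b - a) + c 1 / 2 * (b ^ 2 - a ^ 2) + c 2 / 3 * (b ^ 3 - a ^ 3)
      + c 3 / 4 * (b ^ 4 - a ^ 4) + c 4 / 5 * (b ^ 5 - a ^ 5) + c 5 / 6 * (b ^ 6 - a ^ 6)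
      + c 6 / 7 * (b ^ 7 - a ^ 7) := by
  rw [integral_eq_sub_of_hasDerivAt (f := fun t => c 0 * t + c 1 / 2 * t ^ 2 + c 2 / 3 * t ^ 3
    + c 3 / 4 * t ^ 4 + c 4 / 5 * t ^ 5 + c 5 / 6 * t ^ 6 + c 6 / 7 * t ^ 7)
    (fun x _ => ?_) (Continuous.intervalIntegrable (by fun_prop) a b)]
  · ring
  · refine ((((((((hasDerivAt_id x).const_mul (c 0)).add
      ((hasDerivAt_pow 2 x).const_mul (c 1 / 2))).add
      ((hasDerivAt_pow 3 x).const_mul (c 2 / 3))).add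
      ((hasDerivAt_pow 4 x).const_mul (c 3 / 4))).add
      ((hasDerivAt_pow 5 x).const_mul (c 4 / 5))).add
      ((hasDerivAt_pow 6 x).const_mul (c 5 / 6))).add
      ((hasDerivAt_pow 7 x).const_mul (c 6 / 7))).congr_deriv ?_
    norm_num; ring

/-- An integral against a nonnegative continuous weight is bounded by a bound on the integrand
times the integral of the weight. -/
theorem abs_integral_mul_le_of_abs_le {p g : ℝ → ℝ} {a b C : ℝ} (hab : a ≤ b)
    (hp : Continuous p) (hp0 : ∀ t ∈ Icc a b, 0 ≤ p t) (hg : ∀ t ∈ Icc a b, |g t| ≤ C) :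
    |∫ t in a..b, p t * g t| ≤ (∫ t in a..b, p t) * C := by
  rw [← integral_mul_const, ← Real.norm_eq_abs]
  refine norm_integral_le_of_norm_le hab (Filter.Eventually.of_forall fun t ht => ?_)
    ((hp.mul continuous_const).intervalIntegrable a b)
  have ht' := Ioc_subset_Icc_self ht
  rw [Real.norm_eq_abs, abs_mul, abs_of_nonneg (hp0 t ht')]
  exact mul_le_mul_of_nonneg_left (hg t ht') (hp0 t ht')

/-- The coefficients of `120` times the Peano kernel of `T` on `[√3 / 3, 1]`. -/
noncomputable def outerKernelCoeff : ℕ → ℝ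
  | 0 => -1 / 30
  | 1 => 1 / 3
  | 2 => -7 / 6
  | 3 => 2
  | 4 => -11 / 6
  | 5 => 13 / 15
  | _ => -1 / 6

/-- The coefficients of `120` times the Peano kernel of `T` on `[0, s]`, where `s = √3 / 3`. -/
noncomputable def innerKernelCoeff (s : ℝ) : ℕ → ℝ
  | 0 => -1 / 30 + s / 15
  | 1 => 0
  | 2 => -7 / 6 + 2 * s
  | 3 => 0
  | 4 => -11 / 6 + 3 * s
  | 5 => 4 / 15
  | _ => -1 / 6

theorem innerKernel_nonneg {s t : ℝ} (hs0 : 0 ≤ s) (hs : s ^ 2 = 1 / 3) (ht : t ∈ Icc 0 s) :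
    0 ≤ innerKernelCoeff s 0 + innerKernelCoeff s 1 * t + innerKernelCoeff s 2 * t ^ 2
      + innerKernelCoeff s 3 * t ^ 3 + innerKernelCoeff s 4 * t ^ 4 + innerKernelCoeff s 5 * t ^ 5
      + innerKernelCoeff s 6 * t ^ 6 := by
  have hs_lo : 0.577 < s := by nlinarith
  have hs_hi : s < 0.578 := by nlinarith
  have s3 : s ^ 3 = s / 3 := by rw [pow_succ, hs]; ring
  have s4 : s ^ 4 = 1 / 9 := by rw [pow_succ, s3]; linear_combination hs / 3
  have s5 : s ^ 5 = s / 9 := by rw [pow_succ, s4]; ring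
  obtain ⟨ht0, hts⟩ := ht
  simp only [innerKernelCoeff]
  rcases le_total t (1 / 5) with ht | ht
  · have t2 : t ^ 2 ≤ 1 / 25 := by nlinarith
    have t4 : t ^ 4 ≤ 1 / 625 := by nlinarith [sq_nonneg t]
    have t56 : 0 ≤ 4 / 15 * t ^ 5 - 1 / 6 * t ^ 6 := by
      have : 0 ≤ t ^ 5 * (4 / 15 - 1 / 6 * t) := mul_nonneg (by positivity) (by linarith)
      linarith
    have q2 : (7 / 6 - 2 * s) * t ^ 2 ≤ 0.013 * (1 / 25) :=
      mul_le_mul (by linarith) t2 (by positivity) (by norm_num)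
    have q4 : (11 / 6 - 3 * s) * t ^ 4 ≤ 0.11 * (1 / 625) :=
      mul_le_mul (by linarith) t4 (by positivity) (by norm_num)
    linarith
  · have k1 : 0 ≤ (1 - t) ^ 5 * (t / 6 - 1 / 30) :=
      mul_nonneg (pow_nonneg (by linarith) 5) (by linarith)
    have k2 : 0 ≤ (s - t) ^ 5 := pow_nonneg (by linarith) 5
    have : (1 - t) ^ 5 * (t / 6 - 1 / 30) + 3 / 5 * (s - t) ^ 5 =
        -1 / 30 + s / 15 + 0 * t + (-7 / 6 + 2 * s) * t ^ 2 + 0 * t ^ 3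
        + (-11 / 6 + 3 * s) * t ^ 4 + 4 / 15 * t ^ 5 + -1 / 6 * t ^ 6 := by
      linear_combination 3 / 5 * s5 - 3 * t * s4 + 6 * t ^ 2 * s3 - 6 * t ^ 3 * hs
    linarith

theorem outerKernel_nonneg {t : ℝ} (ht : t ∈ Icc (1 / 5) 1) :
    0 ≤ outerKernelCoeff 0 + outerKernelCoeff 1 * t + outerKernelCoeff 2 * t ^ 2
      + outerKernelCoeff 3 * t ^ 3 + outerKernelCoeff 4 * t ^ 4 + outerKernelCoeff 5 * t ^ 5
      + outerKernelCoeff 6 * t ^ 6 := by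
  obtain ⟨hts, ht1⟩ := ht
  have k1 : 0 ≤ (1 - t) ^ 5 * (t / 6 - 1 / 30) :=
    mul_nonneg (pow_nonneg (by linarith) 5) (by linarith)
  simp only [outerKernelCoeff]
  linarith

/-- The error bound for the even part of the integrand. The family `h` consists of the successive
derivatives of `h 0` on `[0, 1]`. -/
theorem abs_T_quadrature_even_le {h : ℕ → ℝ → ℝ} {M s : ℝ} (hs0 : 0 ≤ s) (hs : s ^ 2 = 1 / 3)
    (hc : ∀ k ≤ 6, ContinuousOn (h k) (Icc 0 1))
    (hd : ∀ k < 6, ∀ x ∈ Ioo (0 : ℝ) 1, HasDerivAt (h k) (h (k + 1) x) x)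
    (h1 : h 1 0 = 0) (h3 : h 3 0 = 0) (h5 : h 5 0 = 0)
    (hM : ∀ t ∈ Icc (0 : ℝ) 1, |h 6 t| ≤ 2 * M) :
    |2 / 15 * h 0 1 + 4 / 15 * h 0 0 + 3 / 5 * h 0 s - ∫ t in (0 : ℝ)..1, h 0 t| ≤ M / 28350 := by
  have hs_lo : 1 / 5 ≤ s := by nlinarith
  have hs1 : s ≤ 1 := by nlinarith
  have s3 : s ^ 3 = s / 3 := by rw [pow_succ, hs]; ring
  have s4 : s ^ 4 = 1 / 9 := by rw [pow_succ, s3]; linear_combination hs / 3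
  have s5 : s ^ 5 = s / 9 := by rw [pow_succ, s4]; ring
  have s6 : s ^ 6 = 1 / 27 := by rw [pow_succ, s5]; linear_combination hs / 9
  have sub1 : Icc 0 s ⊆ Icc (0 : ℝ) 1 := Icc_subset_Icc_right hs1
  have sub2 : Icc s 1 ⊆ Icc (0 : ℝ) 1 := Icc_subset_Icc_left hs0
  have e1 := integral_sextic_mul_sixth_deriv hs0 (innerKernelCoeff s)
    (fun k hk => (hc k hk).mono sub1)
    (fun k hk x hx => hd k hk x ⟨hx.1, hx.2.trans_le hs1⟩) _ _ _ _ _ _ rfl rfl rfl rfl rfl rfl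
  have e2 := integral_sextic_mul_sixth_deriv hs1 outerKernelCoeff
    (fun k hk => (hc k hk).mono sub2)
    (fun k hk x hx => hd k hk x ⟨hs0.trans_lt hx.1, hx.2⟩) _ _ _ _ _ _ rfl rfl rfl rfl rfl rfl
  have b1 := abs_integral_mul_le_of_abs_le (g := h 6) (C := 2 * M) (p := fun t =>
      innerKernelCoeff s 0 + innerKernelCoeff s 1 * t + innerKernelCoeff s 2 * t ^ 2
      + innerKernelCoeff s 3 * t ^ 3 + innerKernelCoeff s 4 * t ^ 4 + innerKernelCoeff s 5 * t ^ 5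
      + innerKernelCoeff s 6 * t ^ 6) hs0 (by fun_prop)
    (fun t ht => innerKernel_nonneg hs0 hs ht) (fun t ht => hM t (sub1 ht))
  have b2 := abs_integral_mul_le_of_abs_le (g := h 6) (C := 2 * M) (p := fun t =>
      outerKernelCoeff 0 + outerKernelCoeff 1 * t + outerKernelCoeff 2 * t ^ 2
      + outerKernelCoeff 3 * t ^ 3 + outerKernelCoeff 4 * t ^ 4 + outerKernelCoeff 5 * t ^ 5
      + outerKernelCoeff 6 * t ^ 6) hs1 (by fun_prop)
    (fun t ht => outerKernel_nonneg ⟨by linarith [ht.1], ht.2⟩) (fun t ht => hM t (sub2 ht))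
  rw [integral_sextic, e1] at b1
  rw [integral_sextic, e2] at b2
  have hsplit := integral_add_adjacent_intervals
    (((hc 0 (by norm_num)).mono sub1).intervalIntegrable_of_Icc hs0 (μ := MeasureTheory.volume))
    (((hc 0 (by norm_num)).mono sub2).intervalIntegrable_of_Icc hs1)
  rw [← hsplit]
  simp only [innerKernelCoeff, outerKernelCoeff, h1, h3, h5] at b1 b2
  have b := (abs_add_le _ _).trans (add_le_add b1 b2)
  have habs : ∀ {x y C : ℝ}, |x| ≤ C → x = 120 * y → |y| ≤ C / 120 := by
    intro x y C hx hxy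
    rw [hxy, abs_mul, abs_of_pos (by norm_num : (0 : ℝ) < 120)] at hx
    linarith
  refine (habs b ?_).trans (le_of_eq ?_)
  · ring_nf
    simp only [hs, s3, s4, s5]
    ring
  · ring_nf
    simp only [hs, s4, s6]
    ring

/-- Proposition 5 (error bound): for `f ∈ C⁶([−1, 1])` with
`M = sup{ |f⁽⁶⁾(x)| : x ∈ [−1, 1] }`, the quadrature
`T(f) = (2/5)·Smp(f) + (3/5)·G₂(f)` satisfies `|T(f) − ∫_{−1}^{1} f| ≤ M / 28350`. -/
theorem error_bound_T_quadrature
    (f : ℝ → ℝ) (hf : ContDiffOn ℝ 6 f (Set.Icc (-1) 1)) (M : ℝ)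
    (hM : M = sSup ((fun x => |iteratedDerivWithin 6 f (Set.Icc (-1) 1) x|) ''
      Set.Icc (-1 : ℝ) 1)) :
    |2 / 5 * (1 / 3 * (f (-1) + 4 * f 0 + f 1)) +
        3 / 5 * (f (-(Real.sqrt 3 / 3)) + f (Real.sqrt 3 / 3)) -
      ∫ t in (-1 : ℝ)..1, f t| ≤ M / 28350 := by
  set I := Icc (-1 : ℝ) 1
  set D : ℕ → ℝ → ℝ := fun k => iteratedDerivWithin k f I
  have hu : UniqueDiffOn ℝ I := uniqueDiffOn_Icc (by norm_num)
  have D0 : D 0 = f := iteratedDerivWithin_zero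
  have Dc : ∀ k ≤ 6, ContinuousOn (D k) I := fun k hk =>
    hf.continuousOn_iteratedDerivWithin (by exact_mod_cast hk) hu
  have Dd : ∀ k < 6, ∀ x ∈ Ioo (-1 : ℝ) 1, HasDerivAt (D k) (D (k + 1) x) x := by
    intro k hk x hx
    have hd := hf.differentiableOn_iteratedDerivWithin (m := k) (by exact_mod_cast hk) hu x
      (Ioo_subset_Icc_self hx)
    have := hd.hasDerivWithinAt.hasDerivAt (Icc_mem_nhds hx.1 hx.2)
    rwa [← iteratedDerivWithin_succ] at this
  have DM : ∀ x ∈ I, |D 6 x| ≤ M := by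
    intro x hx
    rw [hM]
    exact le_csSup (isCompact_Icc.image_of_continuousOn (Dc 6 le_rfl).abs).bddAbove
      (mem_image_of_mem _ hx)
  have mem : ∀ {t : ℝ}, t ∈ Icc (0 : ℝ) 1 → t ∈ I ∧ -t ∈ I := fun ht =>
    ⟨⟨by linarith [ht.1], ht.2⟩, ⟨by linarith [ht.2], by linarith [ht.1]⟩⟩
  have key := abs_T_quadrature_even_le (M := M) (s := √3 / 3)
    (h := fun k t => D k t + (-1) ^ k * D k (-t)) (by positivity)
    (by rw [div_pow, Real.sq_sqrt (by norm_num)]; norm_num)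
    (fun k hk => ((Dc k hk).mono fun t ht => (mem ht).1).add (continuousOn_const.mul
      ((Dc k hk).comp continuousOn_neg fun t ht => (mem ht).2)))
    (fun k hk x hx => by
      have h1 := Dd k hk x ⟨by linarith [hx.1], hx.2⟩
      have h2 := (Dd k hk (-x) ⟨by linarith [hx.2], by linarith [hx.1]⟩).scomp x (hasDerivAt_neg x)
      refine (h1.add (h2.const_mul ((-1) ^ k))).congr_deriv ?_
      simp only [smul_eq_mul]
      ring)
    (by norm_num) (by norm_num) (by norm_num)
    (fun t ht => by
      have h1 := DM t (mem ht).1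
      have h2 := DM (-t) (mem ht).2
      norm_num
      exact (abs_add_le _ _).trans (by linarith))
  have fc : ContinuousOn f I := hf.continuousOn
  have i1 : IntervalIntegrable f MeasureTheory.volume (-1) 0 :=
    (fc.mono (Icc_subset_Icc_right (by norm_num))).intervalIntegrable_of_Icc (by norm_num)
  have i2 : IntervalIntegrable f MeasureTheory.volume 0 1 :=
    (fc.mono (Icc_subset_Icc_left (by norm_num))).intervalIntegrable_of_Icc (by norm_num)
  have i3 : IntervalIntegrable (fun t => f (-t)) MeasureTheory.volume 0 1 :=
    (fc.comp continuousOn_neg fun t ht => (mem ht).2).intervalIntegrable_of_Icc (by norm_num)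
  have hint : ∫ t in (-1 : ℝ)..1, f t = ∫ t in (0 : ℝ)..1, (f t + f (-t)) := by
    rw [integral_add i2 i3, integral_comp_neg, ← integral_add_adjacent_intervals i1 i2, neg_zero,
      add_comm]
  simp only [D0, pow_zero, one_mul, neg_zero] at key
  rw [hint]
  convert key using 2
  ring
end

section
/- Let f : [−1, 1] → ℝ be 3-convex and even (f(−x) = f(x) for all x ∈ [−1, 1]). Then for any u, v with 0 < u < v ≤ 1 one has v²·f(u) ≤ u²·f(v) + (v² − u²)·f(0). -/
/-- For a `3`-convex even function `f` on `[−1, 1]` and `0 < u < v ≤ 1`, one has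
`v²·f(u) ≤ u²·f(v) + (v² − u²)·f(0)`. -/
theorem even_three_convex_inequality
    (f : ℝ → ℝ) (hf : NConvexOn 3 (Set.Icc (-1) 1) f)
    (heven : ∀ x ∈ Set.Icc (-1 : ℝ) 1, f (-x) = f x)
    (u v : ℝ) (hu : 0 < u) (huv : u < v) (hv : v ≤ 1) :
    v ^ 2 * f u ≤ u ^ 2 * f v + (v ^ 2 - u ^ 2) * f 0 := by
  have h := hf [-v, -u, 0, u, v] rfl
    (by
      simp only [List.nodup_cons, List.mem_cons, List.not_mem_nil, or_false, not_or,
        not_false_eq_true, List.nodup_nil, and_true]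
      refine ⟨⟨?_, ?_, ?_, ?_⟩, ⟨?_, ?_, ?_⟩, ⟨?_, ?_⟩, ?_⟩ <;> intro h <;> linarith)
    (by
      simp only [List.forall_mem_cons, Set.mem_Icc]
      refine ⟨⟨?_, ?_⟩, ⟨?_, ?_⟩, ⟨?_, ?_⟩, ⟨?_, ?_⟩, ⟨?_, ?_⟩, by simp⟩ <;> linarith)
  simp only [divDiff, List.dropLast, List.getLast_cons_cons, List.getLast_singleton] at h
  rw [heven u ⟨by linarith, by linarith⟩, heven v ⟨by linarith, by linarith⟩] at h
  have hv₀ : 0 < v := hu.trans huv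
  have hd : 0 < v - u := sub_pos.mpr huv
  have hs : 0 < u + v := by positivity
  have hp : 0 < u ^ 2 * v ^ 2 * ((v - u) * (u + v)) := by positivity
  have key := mul_nonneg hp.le h
  have h_expand : ∀ a b c : ℝ, u ^ 2 * v ^ 2 * ((v - u) * (u + v)) *
      (((((a - b) / (v - u) - (b - c) / (u - 0)) / (v - 0) -
        ((b - c) / (u - 0) - (c - b) / (0 - -u)) / (u - -u)) / (v - -u) -
        (((b - c) / (u - 0) - (c - b) / (0 - -u)) / (u - -u) -
          ((c - b) / (0 - -u) - (b - a) / (-u - -v)) / (0 - -v)) / (u - -v)) / (v - -v)) =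
      u ^ 2 * a - v ^ 2 * b + (v ^ 2 - u ^ 2) * c := by
    intro a b c
    have e₁ : -u - -v = v - u := by ring
    have e₂ : v - -u = u + v := by ring
    have e₃ : u - -u = 2 * u := by ring
    have e₄ : v - -v = 2 * v := by ring
    rw [e₁, e₂, e₃, e₄]
    simp only [sub_zero, sub_neg_eq_add]
    field_simp
    ring
  rw [h_expand] at key
  linarith
end
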